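/- arXiv:2410.22569 — 3 statements merged into one kernel-verified Lean document; each statement's English description precedes it below -/
import Mathlib

section
/- Let (X₁,…,X_n) be a centered Gaussian random vector in (ℝ^d)^n with a log-concave Lebesgue density, and let A₁,…,A_m be symmetric convex subsets of ℝ^d. For linear maps f₁,…,f_m : (ℝ^d)^n → ℝ^d, the function t ↦ P(f₁(X) + t·z₁' ∈ A₁, …, f_m(X) + t·z_m' ∈ A_m) is non-increasing on [0,∞) for any fixed shift vectors z₁',…,z_m' ∈ ℝ^d. -/
open MeasureTheory ProbabilityTheory

/-- A centered Gaussian (probability) measure on a real normed space. -/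
def IsCenteredGaussian {X : Type*} [NormedAddCommGroup X] [NormedSpace ℝ X]
    [MeasurableSpace X] [BorelSpace X] (μ : Measure X) : Prop :=
  IsProbabilityMeasure μ ∧ ∀ L : X →L[ℝ] ℝ, ∃ v : NNReal, μ.map L = gaussianReal 0 v

open Set
open scoped ENNReal Pointwise

/-- The Prékopa–Leindler inequality for nonnegative measurable functions on a measure space that
is also a real vector space. -/
def PrekopaLeindler (E : Type*) [AddCommGroup E] [Module ℝ E] [MeasureSpace E] : Prop :=
  ∀ a b : ℝ, 0 < a → 0 < b → a + b = 1 → ∀ f g h : E → ℝ≥0∞,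
    Measurable f → Measurable g → Measurable h →
    (∀ x y, f x ^ a * g y ^ b ≤ h (a • x + b • y)) →
    (∫⁻ x, f x) ^ a * (∫⁻ x, g x) ^ b ≤ ∫⁻ x, h x

theorem ENNReal.rpow_mul_rpow_le_add {a b : ℝ} (ha : 0 < a) (hb : 0 < b) (hab : a + b = 1)
    (x y : ℝ≥0∞) :
    x ^ a * y ^ b ≤ ENNReal.ofReal a * x + ENNReal.ofReal b * y := by
  have hpq : (a⁻¹).HolderConjugate b⁻¹ := by
    refine Real.holderConjugate_iff.2 ⟨?_, by simpa using hab⟩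
    exact (one_lt_inv₀ ha).2 (by linarith)
  have h := ENNReal.young_inequality (x ^ a) (y ^ b) hpq
  rw [ENNReal.rpow_rpow_inv ha.ne', ENNReal.rpow_rpow_inv hb.ne', ENNReal.ofReal_inv_of_pos ha,
    ENNReal.ofReal_inv_of_pos hb, ENNReal.div_eq_inv_mul, ENNReal.div_eq_inv_mul, inv_inv,
    inv_inv] at h
  exact h

theorem IsCompact.volume_add_volume_le {K L S : Set ℝ} {a b : ℝ} (ha : 0 < a) (hb : 0 < b)
    (hK : IsCompact K) (hL : IsCompact L) (hK' : K.Nonempty) (hL' : L.Nonempty)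
    (hS : ∀ x ∈ K, ∀ y ∈ L, a * x + b * y ∈ S) :
    ENNReal.ofReal a * volume K + ENNReal.ofReal b * volume L ≤ volume S := by
  obtain ⟨x₀, hx₀, hmax⟩ := hK.exists_isGreatest hK'
  obtain ⟨y₀, hy₀, hmin⟩ := hL.exists_isLeast hL'
  have image_volume (c d : ℝ) (hc : 0 < c) (T : Set ℝ) :
      volume ((fun x => d + x) '' (c • T)) = ENNReal.ofReal c * volume T := by
    rw [image_add_left, measure_preimage_add, Measure.addHaar_smul_of_nonneg _ hc.le]
    simp
  have hKS : (fun x => b * y₀ + x) '' (a • K) ⊆ S ∩ Iic (a * x₀ + b * y₀) := by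
    rintro _ ⟨_, ⟨x, hx, rfl⟩, rfl⟩
    have := mul_le_mul_of_nonneg_left (hmax hx) ha.le
    exact ⟨by simpa [add_comm] using hS x hx y₀ hy₀, by simp; linarith⟩
  have hLS : (fun x => a * x₀ + x) '' (b • L) ⊆ S ∩ Ici (a * x₀ + b * y₀) := by
    rintro _ ⟨_, ⟨y, hy, rfl⟩, rfl⟩
    have := mul_le_mul_of_nonneg_left (hmin hy) hb.le
    exact ⟨by simpa using hS x₀ hx₀ y hy, by simp; linarith⟩
  have hIci : volume (S ∩ Ici (a * x₀ + b * y₀)) ≤ volume (S \ Iic (a * x₀ + b * y₀)) := by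
    have hsub : S ∩ Ici (a * x₀ + b * y₀) ⊆
        (S \ Iic (a * x₀ + b * y₀)) ∪ {a * x₀ + b * y₀} := by
      rintro z ⟨hz, hz'⟩
      rcases eq_or_lt_of_le (mem_Ici.1 hz') with h | h
      · exact Or.inr h.symm
      · exact Or.inl ⟨hz, not_le.2 h⟩
    simpa using (measure_mono (μ := volume) hsub).trans (measure_union_le _ _)
  calc ENNReal.ofReal a * volume K + ENNReal.ofReal b * volume L
      ≤ volume (S ∩ Iic (a * x₀ + b * y₀)) + volume (S \ Iic (a * x₀ + b * y₀)) := by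
        rw [← image_volume a (b * y₀) ha K, ← image_volume b (a * x₀) hb L]
        exact add_le_add (measure_mono hKS) ((measure_mono hLS).trans hIci)
    _ = volume S := measure_inter_add_sdiff _ measurableSet_Iic

theorem MeasurableSet.volume_add_volume_le {A B S : Set ℝ} {a b : ℝ} (ha : 0 < a) (hb : 0 < b)
    (hA : MeasurableSet A) (hB : MeasurableSet B) (hA' : A.Nonempty) (hB' : B.Nonempty)
    (hS : ∀ x ∈ A, ∀ y ∈ B, a * x + b * y ∈ S) :
    ENNReal.ofReal a * volume A + ENNReal.ofReal b * volume B ≤ volume S := by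
  obtain ⟨x₀, hx₀⟩ := hA'
  obtain ⟨y₀, hy₀⟩ := hB'
  rw [hA.measure_eq_iSup_isCompact, hB.measure_eq_iSup_isCompact]
  simp only [ENNReal.mul_iSup, iSup_and']
  refine ENNReal.biSup_add_biSup_le' ⟨∅, empty_subset _, isCompact_empty⟩
    ⟨∅, empty_subset _, isCompact_empty⟩ fun K hK L hL => ?_
  refine le_trans ?_ (IsCompact.volume_add_volume_le ha hb (hK.2.insert x₀) (hL.2.insert y₀)
    (insert_nonempty _ _) (insert_nonempty _ _) fun x hx y hy =>
      hS x (insert_subset hx₀ hK.1 hx) y (insert_subset hy₀ hL.1 hy))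
  gcongr <;> exact subset_insert _ _

theorem lintegral_eq_lintegral_volume_lt {f : ℝ → ℝ≥0∞} (hf : Measurable f) (hf1 : ∀ x, f x ≤ 1) :
    ∫⁻ x, f x = ∫⁻ t in Ioi (0 : ℝ), volume {x | ENNReal.ofReal t < f x} := by
  have hfin (x) : f x ≠ ∞ := ((hf1 x).trans_lt ENNReal.one_lt_top).ne
  have h := lintegral_eq_lintegral_meas_lt (f := fun x => (f x).toReal) volume
    (Filter.Eventually.of_forall fun _ => ENNReal.toReal_nonneg) hf.ennreal_toReal.aemeasurable
  simp only [ENNReal.ofReal_toReal (hfin _)] at h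
  rw [h]
  refine setLIntegral_congr_fun measurableSet_Ioi fun t ht => ?_
  simp only [← ENNReal.ofReal_lt_iff_lt_toReal (le_of_lt ht) (hfin _)]

theorem lintegral_add_lintegral_le_of_iSup_eq_one {a b : ℝ} (ha : 0 < a) (hb : 0 < b)
    (hab : a + b = 1) {f g h : ℝ → ℝ≥0∞} (hf : Measurable f) (hg : Measurable g)
    (hh : Measurable h) (hfgh : ∀ x y, f x ^ a * g y ^ b ≤ h (a • x + b • y))
    (hf1 : ⨆ x, f x = 1) (hg1 : ⨆ x, g x = 1) :
    ENNReal.ofReal a * (∫⁻ x, f x) + ENNReal.ofReal b * (∫⁻ x, g x) ≤ ∫⁻ x, h x := by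
  have hfle (x) : f x ≤ 1 := hf1 ▸ le_iSup f x
  have hgle (x) : g x ≤ 1 := hg1 ▸ le_iSup g x
  refine le_trans ?_ (lintegral_mono fun x => min_le_left (h x) 1)
  rw [lintegral_eq_lintegral_volume_lt hf hfle, lintegral_eq_lintegral_volume_lt hg hgle,
    lintegral_eq_lintegral_volume_lt (hh.min measurable_const) fun x => min_le_right _ _]
  refine (add_le_add (lintegral_const_mul_le _ _) (lintegral_const_mul_le _ _)).trans
    ((le_lintegral_add _ _).trans (setLIntegral_mono' measurableSet_Ioi fun t ht => ?_))
  rcases lt_or_ge (ENNReal.ofReal t) 1 with ht1 | ht1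
  · refine MeasurableSet.volume_add_volume_le ha hb (measurableSet_lt measurable_const hf)
      (measurableSet_lt measurable_const hg) (lt_iSup_iff.1 (ht1.trans_eq hf1.symm))
      (lt_iSup_iff.1 (ht1.trans_eq hg1.symm)) fun x hx y hy => lt_min (lt_of_lt_of_le ?_ (hfgh x y)) ht1
    calc ENNReal.ofReal t = ENNReal.ofReal t ^ a * ENNReal.ofReal t ^ b := by
          rw [← ENNReal.rpow_add_of_nonneg _ _ ha.le hb.le, hab, ENNReal.rpow_one]
      _ < f x ^ a * g y ^ b :=
          ENNReal.mul_lt_mul (ENNReal.rpow_lt_rpow hx ha) (ENNReal.rpow_lt_rpow hy hb)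
  · simp [(hfle _).trans ht1 |>.not_gt, (hgle _).trans ht1 |>.not_gt]

theorem prekopaLeindler_real_of_iSup_ne_top {a b : ℝ} (ha : 0 < a) (hb : 0 < b)
    (hab : a + b = 1) {f g h : ℝ → ℝ≥0∞} (hf : Measurable f) (hg : Measurable g)
    (hh : Measurable h) (hfgh : ∀ x y, f x ^ a * g y ^ b ≤ h (a • x + b • y))
    (hf' : ⨆ x, f x ≠ ∞) (hg' : ⨆ x, g x ≠ ∞) :
    (∫⁻ x, f x) ^ a * (∫⁻ x, g x) ^ b ≤ ∫⁻ x, h x := by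
  set M := ⨆ x, f x
  set N := ⨆ x, g x
  rcases eq_or_ne M 0 with hM0 | hM0
  · have : f = 0 := funext fun x => le_antisymm ((le_iSup f x).trans_eq hM0) zero_le
    simp [this, ha]
  rcases eq_or_ne N 0 with hN0 | hN0
  · have : g = 0 := funext fun x => le_antisymm ((le_iSup g x).trans_eq hN0) zero_le
    simp [this, hb]
  have hc0 : M ^ a * N ^ b ≠ 0 := by simp [hM0, hN0, hf', hg']
  have hct : M ^ a * N ^ b ≠ ∞ := by finiteness
  have hscale (x y : ℝ≥0∞) :
      (M⁻¹ * x) ^ a * (N⁻¹ * y) ^ b = (M ^ a * N ^ b)⁻¹ * (x ^ a * y ^ b) := by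
    rw [ENNReal.mul_rpow_of_nonneg _ _ ha.le, ENNReal.mul_rpow_of_nonneg _ _ hb.le,
      ENNReal.inv_rpow, ENNReal.inv_rpow, ENNReal.mul_inv (.inr (by finiteness))
      (.inr (by simp [hN0, hg']))]
    ring
  have key := lintegral_add_lintegral_le_of_iSup_eq_one (f := fun x => M⁻¹ * f x)
    (g := fun x => N⁻¹ * g x) (h := fun x => (M ^ a * N ^ b)⁻¹ * h x) ha hb hab
    (hf.const_mul _) (hg.const_mul _) (hh.const_mul _)
    (fun x y => by rw [hscale]; gcongr; exact hfgh x y)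
    (by rw [← ENNReal.mul_iSup, ENNReal.inv_mul_cancel hM0 hf'])
    (by rw [← ENNReal.mul_iSup, ENNReal.inv_mul_cancel hN0 hg'])
  have := (ENNReal.rpow_mul_rpow_le_add ha hb hab _ _).trans key
  rw [lintegral_const_mul _ hf, lintegral_const_mul _ hg, lintegral_const_mul _ hh, hscale] at this
  exact (ENNReal.mul_le_mul_iff_right (ENNReal.inv_ne_zero.2 hct) (ENNReal.inv_ne_top.2 hc0)).1 this

theorem lintegral_eq_iSup_lintegral_min_natCast {f : ℝ → ℝ≥0∞} (hf : Measurable f) :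
    ∫⁻ x, f x = ⨆ n : ℕ, ∫⁻ x, min (f x) n := by
  rw [← lintegral_iSup (fun n => hf.min measurable_const)
    (fun m n hmn x => min_le_min_left _ (by exact_mod_cast hmn))]
  refine lintegral_congr fun x => ?_
  rw [← inf_iSup_eq, ENNReal.iSup_natCast, inf_top_eq]

theorem ENNReal.iSup_rpow {ι : Sort*} (u : ι → ℝ≥0∞) {a : ℝ} (ha : 0 < a) :
    (⨆ i, u i) ^ a = ⨆ i, u i ^ a :=
  (ENNReal.orderIsoRpow a ha).map_iSup u

theorem prekopaLeindler_real : PrekopaLeindler ℝ := by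
  intro a b ha hb hab f g h hf hg hh hfgh
  rw [lintegral_eq_iSup_lintegral_min_natCast hf, lintegral_eq_iSup_lintegral_min_natCast hg,
    ENNReal.iSup_rpow _ ha, ENNReal.iSup_rpow _ hb]
  simp only [ENNReal.iSup_mul, ENNReal.mul_iSup, iSup_le_iff]
  have hbdd (u : ℝ → ℝ≥0∞) (n : ℕ) : ⨆ x, min (u x) n ≠ ∞ :=
    ne_top_of_le_ne_top (ENNReal.natCast_ne_top n) (iSup_le fun x => min_le_right _ _)
  intro m n
  refine prekopaLeindler_real_of_iSup_ne_top ha hb hab (hf.min measurable_const)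
    (hg.min measurable_const) hh (fun x y => le_trans ?_ (hfgh x y)) (hbdd _ _) (hbdd _ _)
  gcongr <;> exact min_le_left _ _

namespace PrekopaLeindler

theorem prod {E F : Type*} [AddCommGroup E] [Module ℝ E] [MeasureSpace E]
    [SFinite (volume : Measure E)] [AddCommGroup F] [Module ℝ F] [MeasureSpace F]
    [SFinite (volume : Measure F)] (hE : PrekopaLeindler E) (hF : PrekopaLeindler F) :
    PrekopaLeindler (E × F) := by
  intro a b ha hb hab f g h hf hg hh hfgh
  simp only [Measure.volume_eq_prod]
  rw [lintegral_prod _ hf.aemeasurable, lintegral_prod _ hg.aemeasurable,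
    lintegral_prod _ hh.aemeasurable]
  exact hE a b ha hb hab _ _ _ hf.lintegral_prod_right' hg.lintegral_prod_right'
    hh.lintegral_prod_right' fun x y => hF a b ha hb hab _ _ _ (hf.comp measurable_prodMk_left)
      (hg.comp measurable_prodMk_left) (hh.comp measurable_prodMk_left)
      fun x' y' => hfgh (x, x') (y, y')

theorem of_measurePreserving {E F : Type*} [AddCommGroup E] [Module ℝ E] [MeasureSpace E]
    [AddCommGroup F] [Module ℝ F] [MeasureSpace F] (hE : PrekopaLeindler E) (e : E →ₗ[ℝ] F)
    (he : MeasurePreserving e) : PrekopaLeindler F := by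
  intro a b ha hb hab f g h hf hg hh hfgh
  rw [← he.lintegral_comp hf, ← he.lintegral_comp hg, ← he.lintegral_comp hh]
  refine hE a b ha hb hab _ _ _ (hf.comp he.measurable) (hg.comp he.measurable)
    (hh.comp he.measurable) fun x y => ?_
  simpa using hfgh (e x) (e y)

theorem pi {E : Type*} [AddCommGroup E] [Module ℝ E] [MeasureSpace E]
    [SigmaFinite (volume : Measure E)] (hE : PrekopaLeindler E) (n : ℕ) :
    PrekopaLeindler (Fin n → E) := by
  induction n with
  | zero =>
    intro a b ha hb hab f g h hf hg hh hfgh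
    simp only [volume_pi, Measure.pi_of_empty _ (0 : Fin 0 → E), lintegral_dirac' _ hf,
      lintegral_dirac' _ hg, lintegral_dirac' _ hh]
    exact (hfgh 0 0).trans_eq (congrArg h (Subsingleton.elim _ _))
  | succ n ih =>
    refine (hE.prod ih).of_measurePreserving
      (Fin.consLinearEquiv ℝ fun _ : Fin (n + 1) => E).toLinearMap ?_
    convert! (volume_preserving_piFinSuccAbove (fun _ : Fin (n + 1) => E) 0).symm using 1
    ext x
    simp [MeasurableEquiv.piFinSuccAbove]

theorem volume_rpow_mul_rpow_le {E : Type*} [NormedAddCommGroup E] [NormedSpace ℝ E]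
    [MeasureSpace E] [BorelSpace E] (hE : PrekopaLeindler E) {a b : ℝ} (ha : 0 < a) (hb : 0 < b)
    (hab : a + b = 1) {C D S : Set E} (hC : IsOpen C) (hD : IsOpen D)
    (hS : ∀ x ∈ C, ∀ y ∈ D, a • x + b • y ∈ S) :
    volume C ^ a * volume D ^ b ≤ volume S := by
  have hCD : IsOpen (a • C + b • D) := (hD.smul₀ hb.ne').add_left
  have h := hE a b ha hb hab (C.indicator 1) (D.indicator 1) ((a • C + b • D).indicator 1)
    (measurable_one.indicator hC.measurableSet) (measurable_one.indicator hD.measurableSet)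
    (measurable_one.indicator hCD.measurableSet) fun x y => by
      by_cases hx : x ∈ C
      · by_cases hy : y ∈ D
        · have : a • x + b • y ∈ a • C + b • D :=
            add_mem_add (smul_mem_smul_set hx) (smul_mem_smul_set hy)
          simp [hx, hy, this]
        · simp [hy, hb]
      · simp [hx, ha]
  rw [lintegral_indicator_one hC.measurableSet, lintegral_indicator_one hD.measurableSet,
    lintegral_indicator_one hCD.measurableSet] at h
  refine h.trans (measure_mono ?_)
  rintro _ ⟨_, ⟨x, hx, rfl⟩, _, ⟨y, hy, rfl⟩, rfl⟩
  exact hS x hx y hy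

end PrekopaLeindler

theorem Convex.volume_le_of_symmetric_shift {E : Type*} [NormedAddCommGroup E] [NormedSpace ℝ E]
    [FiniteDimensional ℝ E] [MeasureSpace E] [BorelSpace E] [(volume : Measure E).IsAddHaarMeasure]
    (hE : PrekopaLeindler E) {a b : ℝ} (ha : 0 < a) (hb : 0 < b) (hab : a + b = 1) {C S : Set E}
    (hC : Convex ℝ C) (hS : ∀ x ∈ C, ∀ y ∈ C, a • x - b • y ∈ S) :
    volume C ≤ volume S := by
  have hint : volume (interior C) = volume C :=
    measure_congr (interior_ae_eq_of_null_frontier (hC.addHaar_frontier volume))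
  have h := hE.volume_rpow_mul_rpow_le ha hb hab (isOpen_interior (s := C))
    (isOpen_interior (s := C)).neg (S := S) fun x hx y hy => by
      simpa using hS x (interior_subset hx) (-y) (interior_subset hy)
  rwa [Measure.measure_neg, ← ENNReal.rpow_add_of_nonneg _ _ ha.le hb.le, hab, ENNReal.rpow_one,
    hint] at h

theorem convex_setOf_lt_of_logConcave {E : Type*} [AddCommGroup E] [Module ℝ E] {ρ : E → ℝ}
    (hρ : ∀ x, 0 ≤ ρ x)
    (hlc : ∀ x y : E, ∀ a b : ℝ, 0 ≤ a → 0 ≤ b → a + b = 1 →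
      ρ x ^ a * ρ y ^ b ≤ ρ (a • x + b • y)) (r : ℝ) : Convex ℝ {x | r < ρ x} := by
  intro x hx y hy a b ha hb hab
  have hm : 0 ≤ min (ρ x) (ρ y) := le_min (hρ x) (hρ y)
  calc r < min (ρ x) (ρ y) := lt_min hx hy
    _ = min (ρ x) (ρ y) ^ a * min (ρ x) (ρ y) ^ b := by
      rw [← Real.rpow_add_of_nonneg hm ha hb, hab, Real.rpow_one]
    _ ≤ ρ x ^ a * ρ y ^ b := mul_le_mul (Real.rpow_le_rpow hm (min_le_left _ _) ha)
      (Real.rpow_le_rpow hm (min_le_right _ _) hb) (Real.rpow_nonneg hm _)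
      (Real.rpow_nonneg (hρ x) _)
    _ ≤ ρ (a • x + b • y) := hlc x y a b ha hb hab

/-- Let `(X₁,…,X_n)` be a centered Gaussian random vector in
`(ℝ^d)^n` whose law `μ` has an even log-concave Lebesgue density, let
`A₁,…,A_m ⊆ ℝ^d` be symmetric convex sets, `f₁,…,f_m : (ℝ^d)^n → ℝ^d` linear maps,
and `z₁',…,z_m' ∈ ℝ^d` shift vectors.  Then
`t ↦ P(f₁(X) + t·z₁' ∈ A₁, …, f_m(X) + t·z_m' ∈ A_m)` is non-increasing on `[0,∞)`. -/
theorem gaussian_shift_antitone (d n m : ℕ)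
    (μ : Measure (Fin n → Fin d → ℝ)) (hGauss : IsCenteredGaussian μ)
    (ρ : (Fin n → Fin d → ℝ) → ℝ)
    (hρ_nonneg : ∀ x, 0 ≤ ρ x)
    (hdensity : μ = volume.withDensity fun x => ENNReal.ofReal (ρ x))
    (heven : ∀ x, ρ (-x) = ρ x)
    (hlogconcave : ∀ x y : Fin n → Fin d → ℝ, ∀ a b : ℝ, 0 ≤ a → 0 ≤ b → a + b = 1 →
      ρ x ^ a * ρ y ^ b ≤ ρ (a • x + b • y))
    (A : Fin m → Set (Fin d → ℝ))
    (hAconv : ∀ j, Convex ℝ (A j))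
    (hAsymm : ∀ j, ∀ v ∈ A j, -v ∈ A j)
    (f : Fin m → ((Fin n → Fin d → ℝ) →ₗ[ℝ] (Fin d → ℝ)))
    (z : Fin m → Fin d → ℝ) :
    AntitoneOn (fun t : ℝ => μ {x | ∀ j, f j x + t • z j ∈ A j}) (Set.Ici 0) := by
  have hE : PrekopaLeindler (Fin n → Fin d → ℝ) := (prekopaLeindler_real.pi d).pi n
  have hK := convex_setOf_lt_of_logConcave hρ_nonneg hlogconcave
  have hρ_meas : AEMeasurable ρ :=
    NullMeasurable.aemeasurable fun s hs =>
      measurable_of_Ioi (δ := NullMeasurableSpace (Fin n → Fin d → ℝ) volume) (f := ρ)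
        (fun r => (hK r).nullMeasurableSet volume) hs
  have hconv (t : ℝ) : Convex ℝ {x | ∀ j, f j x + t • z j ∈ A j} := by
    intro x hx y hy a b ha hb hab j
    convert! hAconv j (hx j) (hy j) ha hb hab using 1
    obtain rfl : b = 1 - a := by linarith
    rw [map_add, map_smul, map_smul]
    module
  have hμ (t : ℝ) : μ {x | ∀ j, f j x + t • z j ∈ A j} =
      ∫⁻ r in Ioi (0 : ℝ), volume ({x | r < ρ x} ∩ {x | ∀ j, f j x + t • z j ∈ A j}) := by
    rw [hdensity, withDensity_apply' _ _, lintegral_eq_lintegral_meas_lt _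
      (Filter.Eventually.of_forall hρ_nonneg) hρ_meas.restrict]
    simp only [Measure.restrict_apply₀' ((hconv t).nullMeasurableSet volume)]
  intro s hs t ht hst
  rcases eq_or_lt_of_le hst with rfl | hlt
  · exact le_rfl
  have ht0 : 0 < t := lt_of_le_of_lt hs hlt
  have hs0 : 0 ≤ s := hs
  obtain ⟨a, b, ha, hb, hab, rfl⟩ :
      ∃ a b : ℝ, 0 < a ∧ 0 < b ∧ a + b = 1 ∧ s = a * t - b * t :=
    ⟨(t + s) / (2 * t), (t - s) / (2 * t), by positivity,
      div_pos (sub_pos.2 hlt) (by positivity), by field_simp; ring, by field_simp; ring⟩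
  simp only [hμ]
  refine lintegral_mono fun r => Convex.volume_le_of_symmetric_shift hE ha hb hab
    ((hK r).inter (hconv t)) fun x hx y hy => ?_
  rw [sub_eq_add_neg (a • x), ← smul_neg]
  refine ⟨hK r hx.1 (hy.1.trans_eq (heven y).symm) ha.le hb.le hab, fun j => ?_⟩
  convert! hAconv j (hx.2 j) (hAsymm j _ (hy.2 j)) ha.le hb.le hab using 1
  rw [map_add, map_smul, map_smul, map_neg]
  module
end

section
/- Let H be a self-adjoint operator on a Hilbert space ℋ = L²(X, dm) bounded below with inf spec H = 0, such that e^{-tH} is positivity improving for all large t > 0. Then the following are equivalent: (1) H has a unique, strictly positive ground state; (2) there exists ψ ∈ ℋ with ψ ≥ 0 and liminf_{t→∞} ⟨ψ, e^{-tH}ψ⟩/⟨ψ, e^{-2tH}ψ⟩^{1/2} > 0; (3) for all ψ ∈ ℋ with ψ ≥ 0 and m({ψ > 0}) > 0, liminf_{t→∞} ⟨ψ, e^{-tH}ψ⟩/⟨ψ, e^{-2tH}ψ⟩^{1/2} > 0. -/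
open MeasureTheory Filter
open scoped RealInnerProductSpace

theorem le_mul_of_sq_le_mul_succ {b : ℕ → ℝ} {A C q : ℝ} (hb : ∀ k, 0 ≤ b k) (hA : 0 ≤ A)
    (hq : 0 ≤ q) (hlog : ∀ k, b k ^ 2 ≤ A * b (k + 1)) (hdecay : ∀ k, b k ≤ C * q ^ 2 ^ k) :
    b 0 ≤ q * A := by
  rcases hA.eq_or_lt with rfl | hA
  · have := hlog 0
    nlinarith
  have key : ∀ k, b 0 ^ 2 ^ k * A ≤ A ^ 2 ^ k * b k := by
    intro k
    induction k with
    | zero => simp [mul_comm]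
    | succ k ih =>
      refine le_of_mul_le_mul_right ?_ hA
      calc b 0 ^ 2 ^ (k + 1) * A * A = (b 0 ^ 2 ^ k * A) ^ 2 := by ring
        _ ≤ (A ^ 2 ^ k * b k) ^ 2 := pow_le_pow_left₀ (mul_nonneg (pow_nonneg (hb 0) _) hA.le) ih 2
        _ = A ^ 2 ^ (k + 1) * b k ^ 2 := by ring
        _ ≤ A ^ 2 ^ (k + 1) * (A * b (k + 1)) := by gcongr; exact hlog k
        _ = A ^ 2 ^ (k + 1) * b (k + 1) * A := by ring
  by_contra! hlt
  have hb0 : 0 < b 0 := (mul_nonneg hq hA.le).trans_lt hlt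
  have hle : ∀ k : ℕ, A ≤ C * (q * A / b 0) ^ 2 ^ k := by
    intro k
    rw [div_pow, ← mul_div_assoc, le_div_iff₀ (by positivity)]
    calc A * b 0 ^ 2 ^ k = b 0 ^ 2 ^ k * A := mul_comm _ _
      _ ≤ A ^ 2 ^ k * b k := key k
      _ ≤ A ^ 2 ^ k * (C * q ^ 2 ^ k) := by gcongr; exact hdecay k
      _ = C * (q * A) ^ 2 ^ k := by ring
  have hlim : Tendsto (fun k : ℕ => C * (q * A / b 0) ^ 2 ^ k) atTop (nhds (C * 0)) :=
    ((tendsto_pow_atTop_nhds_zero_of_lt_one (by positivity) ((div_lt_one hb0).2 hlt)).comp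
      (tendsto_pow_atTop_atTop_of_one_lt one_lt_two)).const_mul C
  have := ge_of_tendsto' hlim hle
  linarith

/-- A semigroup of symmetric operators of norm one, indexed by `t ≥ 0`. -/
structure IsSymmetricSemigroup {E : Type*} [NormedAddCommGroup E] [InnerProductSpace ℝ E]
    (S : ℝ → E →L[ℝ] E) : Prop where
  map_add : ∀ s t : ℝ, 0 ≤ s → 0 ≤ t → S (s + t) = (S s).comp (S t)
  symmetric : ∀ t : ℝ, 0 ≤ t → ∀ f g : E, ⟪S t f, g⟫ = ⟪f, S t g⟫
  norm_eq_one : ∀ t : ℝ, 0 ≤ t → ‖S t‖ = 1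

namespace IsSymmetricSemigroup

variable {E : Type*} [NormedAddCommGroup E] [InnerProductSpace ℝ E] {S : ℝ → E →L[ℝ] E}

theorem inner_add (hS : IsSymmetricSemigroup S) {s t : ℝ} (hs : 0 ≤ s) (ht : 0 ≤ t) (f : E) :
    ⟪f, S (s + t) f⟫ = ⟪S s f, S t f⟫ := by
  rw [hS.map_add s t hs ht, hS.symmetric s hs, ContinuousLinearMap.comp_apply]

theorem inner_two_mul (hS : IsSymmetricSemigroup S) {t : ℝ} (ht : 0 ≤ t) (f : E) :
    ⟪f, S (2 * t) f⟫ = ‖S t f‖ ^ 2 := by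
  rw [two_mul, hS.inner_add ht ht, real_inner_self_eq_norm_sq]

theorem inner_eq_norm_half_sq (hS : IsSymmetricSemigroup S) {t : ℝ} (ht : 0 ≤ t) (f : E) :
    ⟪f, S t f⟫ = ‖S (t / 2) f‖ ^ 2 := by
  rw [← hS.inner_two_mul (by linarith), mul_div_cancel₀ _ two_ne_zero]

theorem inner_nonneg (hS : IsSymmetricSemigroup S) {t : ℝ} (ht : 0 ≤ t) (f : E) :
    0 ≤ ⟪f, S t f⟫ :=
  hS.inner_eq_norm_half_sq ht f ▸ sq_nonneg _

theorem norm_apply_le (hS : IsSymmetricSemigroup S) {t : ℝ} (ht : 0 ≤ t) (f : E) :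
    ‖S t f‖ ≤ ‖f‖ := by
  simpa [hS.norm_eq_one t ht] using (S t).le_opNorm f

theorem inner_anti (hS : IsSymmetricSemigroup S) {s t : ℝ} (hs : 0 ≤ s) (hst : s ≤ t) (f : E) :
    ⟪f, S t f⟫ ≤ ⟪f, S s f⟫ := by
  rw [hS.inner_eq_norm_half_sq hs, hS.inner_eq_norm_half_sq (hs.trans hst)]
  gcongr
  have : t / 2 = (t - s) / 2 + s / 2 := by ring
  rw [this, hS.map_add _ _ (by linarith) (by linarith)]
  exact hS.norm_apply_le (by linarith) _

/-- Along a dyadic sequence of times, exponential decay of an orbit bounds its first step. -/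
theorem norm_apply_le_of_decay (hS : IsSymmetricSemigroup S) {t C q : ℝ} (ht : 0 ≤ t)
    (hq : 0 ≤ q) {f : E} (h : ∀ k : ℕ, ‖S (2 ^ k * t) f‖ ≤ C * q ^ 2 ^ k) :
    ‖S t f‖ ≤ q * ‖f‖ := by
  have := le_mul_of_sq_le_mul_succ (b := fun k => ‖S (2 ^ k * t) f‖) (fun _ => norm_nonneg _)
    (norm_nonneg f) hq (fun k => ?_) h
  · simpa using this
  · have hk : 0 ≤ 2 ^ k * t := by positivity
    rw [← hS.inner_two_mul hk, ← mul_assoc, ← pow_succ']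
    exact real_inner_le_norm _ _

theorem exists_tendsto [CompleteSpace E] (hS : IsSymmetricSemigroup S) (ψ : E) :
    ∃ u, Tendsto (fun t => S t ψ) atTop (nhds u) ∧ ∀ t, 0 ≤ t → S t u = u := by
  obtain ⟨L, hL⟩ : ∃ L, Tendsto (fun t => ⟪ψ, S t ψ⟫) atTop (nhds L) := by
    have hanti : Antitone fun t : ℝ => ⟪ψ, S (max t 0) ψ⟫ := fun s t hst =>
      hS.inner_anti (le_max_right _ _) (max_le_max_right 0 hst) ψ
    refine ⟨_, (tendsto_atTop_ciInf hanti ⟨0, ?_⟩).congr' ?_⟩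
    · rintro _ ⟨t, rfl⟩
      exact hS.inner_nonneg (le_max_right _ _) ψ
    · filter_upwards [eventually_ge_atTop 0] with t ht
      rw [max_eq_left ht]
  have hcauchy : CauchySeq fun t => S t ψ := by
    rw [Metric.cauchySeq_iff]
    intro ε hε
    obtain ⟨N, hN⟩ := eventually_atTop.1
      (Metric.tendsto_nhds.1 hL (ε ^ 2 / 4) (by positivity))
    refine ⟨max N 0, fun s hs t ht => ?_⟩
    have hs0 : 0 ≤ s := (le_max_right _ _).trans hs
    have ht0 : 0 ≤ t := (le_max_right _ _).trans ht
    have hsN : N ≤ s := (le_max_left _ _).trans hs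
    have htN : N ≤ t := (le_max_left _ _).trans ht
    have h1 := hN (2 * s) (by linarith)
    have h2 := hN (2 * t) (by linarith)
    have h3 := hN (s + t) (by linarith)
    rw [Real.dist_eq, abs_lt] at h1 h2 h3
    rw [hS.inner_two_mul hs0] at h1
    rw [hS.inner_two_mul ht0] at h2
    rw [hS.inner_add hs0 ht0] at h3
    rw [dist_eq_norm]
    refine lt_of_pow_lt_pow_left₀ 2 hε.le ?_
    rw [norm_sub_sq_real]
    linarith [h1.2, h2.2, h3.1]
  obtain ⟨u, hu⟩ := cauchySeq_tendsto_of_complete hcauchy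
  refine ⟨u, hu, fun t ht => ?_⟩
  refine tendsto_nhds_unique (((S t).continuous.tendsto u).comp hu) ?_
  refine (hu.comp (tendsto_atTop_add_const_left atTop t tendsto_id)).congr' ?_
  filter_upwards [eventually_ge_atTop 0] with s hs
  simp [hS.map_add t s ht hs]

theorem quotient_eq (hS : IsSymmetricSemigroup S) {t : ℝ} (ht : 0 ≤ t) (ψ : E) :
    ⟪ψ, S t ψ⟫ / ⟪ψ, S (2 * t) ψ⟫ ^ ((1 : ℝ) / 2) = ⟪ψ, S t ψ⟫ / ‖S t ψ‖ := by
  rw [hS.inner_two_mul ht, ← Real.sqrt_eq_rpow, Real.sqrt_sq (norm_nonneg _)]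

/-- A vector with nonzero overlap with a normalized fixed vector has positive liminf. -/
theorem liminf_pos_of_fixed (hS : IsSymmetricSemigroup S) {ψ ψ₀ : E} (hψ₀ : ‖ψ₀‖ = 1)
    (hfix : ∀ t : ℝ, 0 ≤ t → S t ψ₀ = ψ₀) (hne : ⟪ψ, ψ₀⟫ ≠ 0) :
    0 < liminf (fun t : ℝ => ⟪ψ, S t ψ⟫ / ⟪ψ, S (2 * t) ψ⟫ ^ ((1 : ℝ) / 2)) atTop := by
  have hinner : ∀ t : ℝ, 0 ≤ t → ⟪S t ψ, ψ₀⟫ = ⟪ψ, ψ₀⟫ := fun t ht => by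
    rw [hS.symmetric t ht, hfix t ht]
  have hψ : 0 < ‖ψ‖ := norm_pos_iff.2 fun h => hne (by simp [h])
  refine lt_of_lt_of_le (b := ⟪ψ, ψ₀⟫ ^ 2 / ‖ψ‖) (by positivity) (le_liminf_of_le ?_ ?_)
  · refine IsBoundedUnder.isCoboundedUnder_ge ⟨‖ψ‖, ?_⟩
    rw [eventually_map]
    filter_upwards [eventually_ge_atTop 0] with t ht
    rw [hS.quotient_eq ht]
    exact div_le_of_le_mul₀ (norm_nonneg _) (norm_nonneg _) (real_inner_le_norm _ _)
  · filter_upwards [eventually_ge_atTop 0] with t ht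
    rw [hS.quotient_eq ht]
    have hpos : 0 < ‖S t ψ‖ := norm_pos_iff.2 fun h => hne (by rw [← hinner t ht, h]; simp)
    refine div_le_div₀ (hS.inner_nonneg ht ψ) ?_ hpos (hS.norm_apply_le ht ψ)
    rw [hS.inner_eq_norm_half_sq ht, ← hinner (t / 2) (by linarith), ← sq_abs]
    gcongr
    simpa [hψ₀] using abs_real_inner_le_norm (S (t / 2) ψ) ψ₀

theorem exists_eventually_sq_le (hS : IsSymmetricSemigroup S) {ψ : E}
    (h : 0 < liminf (fun t : ℝ => ⟪ψ, S t ψ⟫ / ⟪ψ, S (2 * t) ψ⟫ ^ ((1 : ℝ) / 2)) atTop) :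
    ∃ c, 0 < c ∧ ψ ≠ 0 ∧ ∀ᶠ t in atTop, c ^ 2 * ⟪ψ, S (2 * t) ψ⟫ ≤ ⟪ψ, S t ψ⟫ ^ 2 := by
  rw [liminf_eq] at h
  obtain ⟨c, hc, hc0⟩ := exists_lt_of_lt_csSup
    (Set.nonempty_iff_ne_empty.2 fun h0 => by rw [h0, Real.sSup_empty] at h; exact h.false) h
  refine ⟨c, hc0, ?_, ?_⟩
  · rintro rfl
    obtain ⟨t, ht⟩ := hc.exists
    simp at ht
    linarith
  · filter_upwards [hc, eventually_ge_atTop 0] with t hct ht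
    rw [hS.quotient_eq ht] at hct
    rw [hS.inner_two_mul ht, ← mul_pow]
    have hpos : 0 < ‖S t ψ‖ := by
      refine (norm_nonneg _).lt_of_ne fun h0 => ?_
      rw [← h0, div_zero] at hct
      linarith
    gcongr
    exact (le_div_iff₀ hpos).1 hct

end IsSymmetricSemigroup

section Lp

variable {X : Type*} [MeasurableSpace X] {m : Measure X}

theorem Lp.inner_eq_integral_mul (f g : Lp ℝ 2 m) : ⟪f, g⟫ = ∫ x, f x * g x ∂m := by
  simp [L2.inner_def, mul_comm]

theorem Lp.inner_nonneg {f g : Lp ℝ 2 m} (hf : 0 ≤ f) (hg : 0 ≤ g) : 0 ≤ ⟪f, g⟫ := by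
  rw [Lp.inner_eq_integral_mul]
  refine integral_nonneg_of_ae ?_
  filter_upwards [(Lp.coeFn_nonneg f).2 hf, (Lp.coeFn_nonneg g).2 hg] with x hx hy
  exact mul_nonneg hx hy

theorem Lp.mul_eq_zero_of_inner_eq_zero {f g : Lp ℝ 2 m} (h : ∀ᵐ x ∂m, 0 ≤ f x * g x)
    (h0 : ⟪f, g⟫ = 0) : ∀ᵐ x ∂m, f x * g x = 0 := by
  have hint : Integrable (fun x => f x * g x) m := by
    simpa [mul_comm] using L2.integrable_inner (𝕜 := ℝ) f g
  rw [Lp.inner_eq_integral_mul] at h0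
  exact (integral_eq_zero_iff_of_nonneg_ae h hint).1 h0

theorem Lp.eq_zero_of_inner_eq_zero {f g : Lp ℝ 2 m} (hf : 0 ≤ f) (hg : ∀ᵐ x ∂m, 0 < g x)
    (h0 : ⟪f, g⟫ = 0) : f = 0 := by
  rw [Lp.eq_zero_iff_ae_eq_zero]
  have : ∀ᵐ x ∂m, 0 ≤ f x * g x := by
    filter_upwards [(Lp.coeFn_nonneg f).2 hf, hg] with x hx hy
    exact mul_nonneg hx hy.le
  filter_upwards [Lp.mul_eq_zero_of_inner_eq_zero this h0, hg] with x hx hy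
  exact (mul_eq_zero.1 hx).resolve_right hy.ne'

theorem Lp.nonneg_of_ae_pos {f : Lp ℝ 2 m} (hf : ∀ᵐ x ∂m, 0 < f x) : 0 ≤ f :=
  (Lp.coeFn_nonneg f).1 (hf.mono fun _ hx => hx.le)

/-- An element orthogonal to all `0 ≤ f ≤ g`, with `g` strictly positive, is nonpositive. -/
theorem Lp.ae_nonpos_of_forall_inner_eq_zero {g h : Lp ℝ 2 m} (hg : ∀ᵐ x ∂m, 0 < g x)
    (hh : ∀ f, 0 ≤ f → f ≤ g → ⟪h, f⟫ = 0) : ∀ᵐ x ∂m, h x ≤ 0 := by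
  have h0 := hh ((h ⊔ 0) ⊓ g) (le_inf le_sup_right (Lp.nonneg_of_ae_pos hg)) inf_le_right
  have hcoe : ∀ᵐ x ∂m, ((h ⊔ 0) ⊓ g : Lp ℝ 2 m) x = min (max (h x) 0) (g x) := by
    filter_upwards [Lp.coeFn_inf (h ⊔ 0) g, Lp.coeFn_sup h 0, Lp.coeFn_zero ℝ 2 m] with x h1 h2 h3
    rw [h1, Pi.inf_apply, h2, Pi.sup_apply, h3, Pi.zero_apply]
  have hnn : ∀ᵐ x ∂m, 0 ≤ h x * ((h ⊔ 0) ⊓ g : Lp ℝ 2 m) x := by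
    filter_upwards [hcoe, hg] with x hx hgx
    rw [hx]
    rcases le_total (h x) 0 with h1 | h1
    · simp [h1, hgx.le]
    · exact mul_nonneg h1 (le_min (le_max_right _ _) hgx.le)
  filter_upwards [Lp.mul_eq_zero_of_inner_eq_zero hnn h0, hcoe, hg] with x hx hc hgx
  by_contra! hpos
  rw [hc, max_eq_left hpos.le] at hx
  exact (mul_pos hpos (lt_min hpos hgx)).ne' hx

theorem Lp.eq_zero_of_forall_inner_eq_zero {g h : Lp ℝ 2 m} (hg : ∀ᵐ x ∂m, 0 < g x)
    (hh : ∀ f, 0 ≤ f → f ≤ g → ⟪h, f⟫ = 0) : h = 0 := by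
  rw [Lp.eq_zero_iff_ae_eq_zero]
  filter_upwards [Lp.ae_nonpos_of_forall_inner_eq_zero hg hh,
    Lp.ae_nonpos_of_forall_inner_eq_zero (h := -h) hg
      (fun f h1 h2 => by rw [inner_neg_left, hh f h1 h2, neg_zero]),
    Lp.coeFn_neg h] with x h1 h2 h3
  rw [h3] at h2
  exact le_antisymm h1 (by simpa using h2)

variable {T : Lp ℝ 2 m →L[ℝ] Lp ℝ 2 m}

theorem Lp.inner_apply_le_of_abs_le (hsym : ∀ f g, ⟪T f, g⟫ = ⟪f, T g⟫)
    (hpos : ∀ f, 0 ≤ f → 0 ≤ T f) {f g : Lp ℝ 2 m} (h : |f| ≤ g) :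
    ⟪f, T f⟫ ≤ ⟪g, T g⟫ := by
  have h1 : 0 ≤ g - f := sub_nonneg.2 ((le_abs_self f).trans h)
  have h2 : 0 ≤ g + f := by simpa using sub_nonneg.2 ((neg_le_abs f).trans h)
  have h3 := Lp.inner_nonneg h1 (hpos _ h2)
  have h4 : ⟪f, T g⟫ = ⟪g, T f⟫ := by rw [← hsym, real_inner_comm]
  rw [_root_.map_add, inner_sub_left, inner_add_right, inner_add_right] at h3
  linarith

theorem Lp.nonneg_of_improving
    (himp : ∀ f : Lp ℝ 2 m, 0 ≤ f → f ≠ 0 → ∀ᵐ x ∂m, 0 < T f x) {f : Lp ℝ 2 m} (hf : 0 ≤ f) :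
    0 ≤ T f := by
  rcases eq_or_ne f 0 with rfl | h0
  · simp
  · exact Lp.nonneg_of_ae_pos (himp f hf h0)

/-- A fixed vector of a positivity improving symmetric contraction has constant sign. -/
theorem Lp.nonneg_or_nonpos_of_fixed (hsym : ∀ f g, ⟪T f, g⟫ = ⟪f, T g⟫) (hnorm : ‖T‖ ≤ 1)
    (himp : ∀ f : Lp ℝ 2 m, 0 ≤ f → f ≠ 0 → ∀ᵐ x ∂m, 0 < T f x) {φ : Lp ℝ 2 m}
    (hφ : T φ = φ) : 0 ≤ φ ∨ φ ≤ 0 := by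
  have habs : T |φ| = |φ| := by
    have h1 := Lp.inner_apply_le_of_abs_le hsym (fun f => Lp.nonneg_of_improving himp)
      (le_refl |φ|)
    rw [hφ, real_inner_self_eq_norm_sq] at h1
    have h2 : ‖T |φ|‖ ≤ ‖φ‖ := by
      rw [← norm_abs_eq_norm φ]
      exact (T.le_opNorm |φ|).trans (mul_le_of_le_one_left (norm_nonneg _) hnorm)
    have h3 := norm_sub_sq_real (T |φ|) |φ|
    rw [norm_abs_eq_norm, real_inner_comm] at h3
    have h4 : ‖T |φ| - |φ|‖ ^ 2 ≤ 0 := by nlinarith [norm_nonneg (T |φ|)]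
    exact sub_eq_zero.1 (norm_eq_zero.1 (pow_eq_zero_iff two_ne_zero |>.1
      (le_antisymm h4 (sq_nonneg _))))
  have hp : 0 ≤ |φ| + φ := by simpa using sub_nonneg.2 (neg_le_abs φ)
  have hn : 0 ≤ |φ| - φ := sub_nonneg.2 (le_abs_self φ)
  by_cases h0 : |φ| + φ = 0
  · right
    rw [eq_neg_of_add_eq_zero_right h0]
    exact neg_nonpos.2 (abs_nonneg φ)
  · left
    have hpos := himp _ hp h0
    rw [_root_.map_add, habs, hφ] at hpos
    have horth : ⟪|φ| - φ, |φ| + φ⟫ = 0 := by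
      rw [inner_sub_left, inner_add_right, inner_add_right, real_inner_self_eq_norm_sq,
        real_inner_self_eq_norm_sq, norm_abs_eq_norm, real_inner_comm]
      ring
    rw [← sub_eq_zero.1 (Lp.eq_zero_of_inner_eq_zero hn hpos horth)]
    exact abs_nonneg φ

theorem Lp.eq_smul_of_fixed (hsym : ∀ f g, ⟪T f, g⟫ = ⟪f, T g⟫) (hnorm : ‖T‖ ≤ 1)
    (himp : ∀ f : Lp ℝ 2 m, 0 ≤ f → f ≠ 0 → ∀ᵐ x ∂m, 0 < T f x) {φ ψ : Lp ℝ 2 m}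
    (hψ1 : ‖ψ‖ = 1) (hψ0 : ∀ᵐ x ∂m, 0 < ψ x) (hψ : T ψ = ψ) (hφ : T φ = φ) :
    φ = ⟪φ, ψ⟫ • ψ := by
  have horth : ⟪φ - ⟪φ, ψ⟫ • ψ, ψ⟫ = 0 := by
    rw [inner_sub_left, real_inner_smul_left, real_inner_self_eq_norm_sq, hψ1]
    ring
  rw [← sub_eq_zero]
  rcases Lp.nonneg_or_nonpos_of_fixed hsym hnorm himp (φ := φ - ⟪φ, ψ⟫ • ψ)
    (by rw [_root_.map_sub, _root_.map_smul, hψ, hφ]) with h | h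
  · exact Lp.eq_zero_of_inner_eq_zero h hψ0 horth
  · refine neg_eq_zero.1 (Lp.eq_zero_of_inner_eq_zero (neg_nonneg.2 h) hψ0 ?_)
    rw [inner_neg_left, horth, neg_zero]

end Lp

namespace IsSymmetricSemigroup

variable {X : Type*} [MeasurableSpace X] {m : Measure X} {S : ℝ → Lp ℝ 2 m →L[ℝ] Lp ℝ 2 m}

/-- If the orbit of one nonnegative nonzero vector decays exponentially along dyadic times, then
positivity improvement forces decay of the whole semigroup, contradicting `‖S t‖ = 1`. -/
theorem not_decay (hS : IsSymmetricSemigroup S) {t₀ : ℝ} (ht₀ : 0 ≤ t₀)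
    (himp : ∀ t, t₀ ≤ t → ∀ f : Lp ℝ 2 m, 0 ≤ f → f ≠ 0 → ∀ᵐ x ∂m, 0 < S t f x)
    {ψ : Lp ℝ 2 m} (hψ : 0 ≤ ψ) (hψ0 : ψ ≠ 0) {t c q : ℝ} (ht : t₀ ≤ t) (hc : 0 ≤ c)
    (hq : 0 ≤ q) (hq1 : q < 1) (hdecay : ∀ k : ℕ, ⟪ψ, S (2 ^ k * t) ψ⟫ ≤ c ^ 2 * q ^ 2 ^ k) :
    False := by
  have ht0 : 0 ≤ t := ht₀.trans ht
  let D : Submodule ℝ (Lp ℝ 2 m) :=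
    { carrier := {f | ∃ C, ∀ k : ℕ, ‖S (2 ^ k * t) f‖ ≤ C * q ^ 2 ^ k}
      zero_mem' := ⟨0, fun k => by simp⟩
      add_mem' := by
        rintro f g ⟨C, hC⟩ ⟨C', hC'⟩
        refine ⟨C + C', fun k => ?_⟩
        rw [_root_.map_add, add_mul]
        exact (norm_add_le _ _).trans (add_le_add (hC k) (hC' k))
      smul_mem' := by
        rintro r f ⟨C, hC⟩
        refine ⟨|r| * C, fun k => ?_⟩
        rw [_root_.map_smul, norm_smul, Real.norm_eq_abs, mul_assoc]
        exact mul_le_mul_of_nonneg_left (hC k) (abs_nonneg r) }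
  have hmem : ∀ f, 0 ≤ f → f ≤ S t₀ ψ → f ∈ D := by
    intro f hf hfg
    refine ⟨c, fun k => ?_⟩
    have hk : t ≤ 2 ^ k * t := le_mul_of_one_le_left ht0 (one_le_pow₀ one_le_two)
    have hk0 : 0 ≤ 2 ^ k * t := ht0.trans hk
    refine le_of_sq_le_sq ?_ (by positivity)
    have hle := Lp.inner_apply_le_of_abs_le (hS.symmetric (2 * (2 ^ k * t)) (by linarith))
      (fun f => Lp.nonneg_of_improving (himp _ (by linarith))) ((abs_of_nonneg hf).trans_le hfg)
    rw [hS.inner_two_mul hk0] at hle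
    have hshift : ⟪S t₀ ψ, S (2 * (2 ^ k * t)) (S t₀ ψ)⟫ =
        ⟪ψ, S (t₀ + (2 * (2 ^ k * t) + t₀)) ψ⟫ := by
      rw [hS.map_add _ _ ht₀ (by linarith), hS.map_add _ _ (by linarith) ht₀, hS.symmetric _ ht₀]
      rfl
    calc ‖S (2 ^ k * t) f‖ ^ 2 ≤ ⟪ψ, S (t₀ + (2 * (2 ^ k * t) + t₀)) ψ⟫ := hshift ▸ hle
      _ ≤ ⟪ψ, S (2 ^ (k + 1) * t) ψ⟫ :=
        hS.inner_anti (by positivity) (by rw [pow_succ', mul_assoc]; linarith) ψ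
      _ ≤ c ^ 2 * q ^ 2 ^ (k + 1) := hdecay (k + 1)
      _ = (c * q ^ 2 ^ k) ^ 2 := by ring
  have hdense : D.topologicalClosure = ⊤ := by
    rw [Submodule.topologicalClosure_eq_top_iff, Submodule.eq_bot_iff]
    intro h hh
    exact Lp.eq_zero_of_forall_inner_eq_zero (himp t₀ le_rfl ψ hψ hψ0)
      fun f h1 h2 => (Submodule.mem_orthogonal' D h).1 hh f (hmem f h1 h2)
  have hbound : ∀ f, ‖S t f‖ ≤ q * ‖f‖ := by
    have hd : Dense (D : Set (Lp ℝ 2 m)) := Submodule.dense_iff_topologicalClosure_eq_top.2 hdense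
    have hcl : IsClosed {f : Lp ℝ 2 m | ‖S t f‖ ≤ q * ‖f‖} :=
      isClosed_le (by fun_prop) (by fun_prop)
    intro f
    refine hcl.closure_subset_iff.2 ?_ (hd f)
    rintro f ⟨C, hC⟩
    exact hS.norm_apply_le_of_decay ht0 hq hC
  have := (S t).opNorm_le_bound hq hbound
  rw [hS.norm_eq_one t ht0] at this
  linarith

theorem exists_groundState_of_liminf_pos (hS : IsSymmetricSemigroup S) {t₀ : ℝ} (ht₀ : 0 ≤ t₀)
    (himp : ∀ t, t₀ ≤ t → ∀ f : Lp ℝ 2 m, 0 ≤ f → f ≠ 0 → ∀ᵐ x ∂m, 0 < S t f x)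
    {ψ : Lp ℝ 2 m} (hψ : 0 ≤ ψ)
    (h : 0 < liminf (fun t : ℝ => ⟪ψ, S t ψ⟫ / ⟪ψ, S (2 * t) ψ⟫ ^ ((1 : ℝ) / 2)) atTop) :
    ∃ ψ₀ : Lp ℝ 2 m, ‖ψ₀‖ = 1 ∧ (∀ᵐ x ∂m, 0 < ψ₀ x) ∧
      (∀ t : ℝ, 0 ≤ t → S t ψ₀ = ψ₀) ∧
      ∀ φ : Lp ℝ 2 m, (∀ t : ℝ, 0 ≤ t → S t φ = φ) → ∃ c : ℝ, φ = c • ψ₀ := by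
  obtain ⟨c, hc, hψ0, hev⟩ := hS.exists_eventually_sq_le h
  obtain ⟨N, hN⟩ := eventually_atTop.1 hev
  have hlower : ∀ t, max N t₀ ≤ t → c ^ 2 ≤ ⟪ψ, S t ψ⟫ := by
    intro t ht
    have hNt : N ≤ t := (le_max_left _ _).trans ht
    have htt : t₀ ≤ t := (le_max_right _ _).trans ht
    have ht0 : 0 ≤ t := ht₀.trans htt
    by_contra! hlt
    refine hS.not_decay ht₀ himp hψ hψ0 htt hc.le
      (div_nonneg (hS.inner_nonneg ht0 ψ) (sq_nonneg c)) ((div_lt_one (by positivity)).2 hlt) ?_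
    intro k
    induction k with
    | zero => simp [mul_div_cancel₀ _ (pow_pos hc 2).ne']
    | succ k ih =>
      have hk : t ≤ 2 ^ k * t := le_mul_of_one_le_left ht0 (one_le_pow₀ one_le_two)
      refine le_of_mul_le_mul_left ?_ (pow_pos hc 2)
      calc c ^ 2 * ⟪ψ, S (2 ^ (k + 1) * t) ψ⟫
          = c ^ 2 * ⟪ψ, S (2 * (2 ^ k * t)) ψ⟫ := by rw [pow_succ' 2 k, mul_assoc 2]
        _ ≤ ⟪ψ, S (2 ^ k * t) ψ⟫ ^ 2 := hN _ (hNt.trans hk)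
        _ ≤ (c ^ 2 * (⟪ψ, S t ψ⟫ / c ^ 2) ^ 2 ^ k) ^ 2 :=
          pow_le_pow_left₀ (hS.inner_nonneg (ht0.trans hk) ψ) ih 2
        _ = c ^ 2 * (c ^ 2 * (⟪ψ, S t ψ⟫ / c ^ 2) ^ 2 ^ (k + 1)) := by
          rw [pow_succ 2 k, pow_mul]; ring
  obtain ⟨u, hu, hfix⟩ := hS.exists_tendsto ψ
  have hu_nonneg : 0 ≤ u := by
    refine ge_of_tendsto hu ?_
    filter_upwards [eventually_ge_atTop t₀] with t ht
    exact Lp.nonneg_of_improving (himp t ht) hψ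
  have hu0 : u ≠ 0 := by
    rintro rfl
    have hlim : Tendsto (fun t => ⟪ψ, S t ψ⟫) atTop (nhds ⟪ψ, (0 : Lp ℝ 2 m)⟫) :=
      tendsto_const_nhds.inner hu
    rw [inner_zero_right] at hlim
    have := ge_of_tendsto hlim ((eventually_ge_atTop (max N t₀)).mono hlower)
    have := pow_pos hc 2
    linarith
  have hu_norm : 0 < ‖u‖ := norm_pos_iff.2 hu0
  have hu_pos : ∀ᵐ x ∂m, 0 < u x := by
    simpa [hfix t₀ ht₀] using himp t₀ le_rfl u hu_nonneg hu0
  have hpos : ∀ᵐ x ∂m, 0 < (‖u‖⁻¹ • u : Lp ℝ 2 m) x := by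
    filter_upwards [Lp.coeFn_smul ‖u‖⁻¹ u, hu_pos] with x hx hux
    rw [hx]
    exact mul_pos (inv_pos.2 hu_norm) hux
  have hnorm1 : ‖‖u‖⁻¹ • u‖ = 1 := by
    rw [norm_smul, norm_inv, norm_norm, inv_mul_cancel₀ hu_norm.ne']
  have hfix1 : ∀ t : ℝ, 0 ≤ t → S t (‖u‖⁻¹ • u) = ‖u‖⁻¹ • u := fun t ht => by
    rw [_root_.map_smul, hfix t ht]
  exact ⟨‖u‖⁻¹ • u, hnorm1, hpos, hfix1, fun φ hφ => ⟨_, Lp.eq_smul_of_fixed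
    (hS.symmetric t₀ ht₀) (hS.norm_eq_one t₀ ht₀).le (himp t₀ le_rfl) hnorm1 hpos
    (hfix1 t₀ ht₀) (hφ t₀ ht₀)⟩⟩

end IsSymmetricSemigroup

/-- Let `H` be a self-adjoint operator on `ℋ = L²(X, dm)`, bounded
below with `inf spec H = 0`, such that `e^{-tH}` is positivity improving for all large
`t`.  We encode the semigroup `S t = e^{-tH}` abstractly: `S` is a symmetric
semigroup of bounded operators with `‖S t‖ = 1` (this is `inf spec H = 0`), and
`S t` is positivity improving for large `t`.  Then the following are equivalent:
(1) `H` has a unique, strictly positive ground state (a positive invariant vector);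
(2) some `ψ ≥ 0` satisfies `liminf_{t→∞} ⟪ψ, S t ψ⟫/⟪ψ, S(2t) ψ⟫^{1/2} > 0`;
(3) every `ψ ≥ 0` with `m({ψ > 0}) > 0` satisfies this liminf condition. -/
theorem ground_state_criteria {X : Type*} [TopologicalSpace X] [MeasurableSpace X]
    [BorelSpace X] (m : Measure X) [m.Regular]
    (S : ℝ → (Lp ℝ 2 m →L[ℝ] Lp ℝ 2 m))
    (hS0 : S 0 = ContinuousLinearMap.id ℝ (Lp ℝ 2 m))
    (hsemi : ∀ s t : ℝ, 0 ≤ s → 0 ≤ t → S (s + t) = (S s).comp (S t))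
    (hsym : ∀ t : ℝ, 0 ≤ t → ∀ f g : Lp ℝ 2 m, ⟪S t f, g⟫ = ⟪f, S t g⟫)
    (hnorm : ∀ t : ℝ, 0 ≤ t → ‖S t‖ = 1)
    (hposimp : ∃ t₀ : ℝ, ∀ t : ℝ, t₀ ≤ t → ∀ f : Lp ℝ 2 m,
      (0 ≤ᵐ[m] (f : X → ℝ)) → ¬((f : X → ℝ) =ᵐ[m] 0) → ∀ᵐ x ∂m, 0 < (S t f : X → ℝ) x) :
    (((∃ ψ₀ : Lp ℝ 2 m, ‖ψ₀‖ = 1 ∧ (∀ᵐ x ∂m, 0 < ψ₀ x) ∧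
        (∀ t : ℝ, 0 ≤ t → S t ψ₀ = ψ₀) ∧
        ∀ φ : Lp ℝ 2 m, (∀ t : ℝ, 0 ≤ t → S t φ = φ) → ∃ c : ℝ, φ = c • ψ₀) ↔
      (∃ ψ : Lp ℝ 2 m, (0 ≤ᵐ[m] (ψ : X → ℝ)) ∧
        0 < liminf (fun t : ℝ =>
          ⟪ψ, S t ψ⟫ / ⟪ψ, S (2 * t) ψ⟫ ^ ((1 : ℝ) / 2)) atTop)) ∧
     ((∃ ψ : Lp ℝ 2 m, (0 ≤ᵐ[m] (ψ : X → ℝ)) ∧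
        0 < liminf (fun t : ℝ =>
          ⟪ψ, S t ψ⟫ / ⟪ψ, S (2 * t) ψ⟫ ^ ((1 : ℝ) / 2)) atTop) ↔
      (∀ ψ : Lp ℝ 2 m, (0 ≤ᵐ[m] (ψ : X → ℝ)) → 0 < m {x | 0 < ψ x} →
        0 < liminf (fun t : ℝ =>
          ⟪ψ, S t ψ⟫ / ⟪ψ, S (2 * t) ψ⟫ ^ ((1 : ℝ) / 2)) atTop))) := by
  have hS : IsSymmetricSemigroup S := ⟨hsemi, hsym, hnorm⟩
  obtain ⟨t₀, ht₀, himp⟩ : ∃ t₀ : ℝ, 0 ≤ t₀ ∧ ∀ t, t₀ ≤ t → ∀ f : Lp ℝ 2 m, 0 ≤ f → f ≠ 0 →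
      ∀ᵐ x ∂m, 0 < S t f x := by
    obtain ⟨t₀, h⟩ := hposimp
    exact ⟨max t₀ 0, le_max_right _ _, fun t ht f hf hf0 => h t ((le_max_left _ _).trans ht) f
      ((Lp.coeFn_nonneg f).2 hf) (mt (Lp.eq_zero_iff_ae_eq_zero).2 hf0)⟩
  have liminf_of_groundState : ∀ ψ₀ : Lp ℝ 2 m, ‖ψ₀‖ = 1 → (∀ᵐ x ∂m, 0 < ψ₀ x) →
      (∀ t : ℝ, 0 ≤ t → S t ψ₀ = ψ₀) → ∀ ψ : Lp ℝ 2 m, 0 ≤ ψ → ψ ≠ 0 →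
      0 < liminf (fun t : ℝ => ⟪ψ, S t ψ⟫ / ⟪ψ, S (2 * t) ψ⟫ ^ ((1 : ℝ) / 2)) atTop :=
    fun ψ₀ h1 hpos hfix ψ hψ hψ0 => hS.liminf_pos_of_fixed h1 hfix
      fun h0 => hψ0 (Lp.eq_zero_of_inner_eq_zero hψ hpos h0)
  refine ⟨⟨?_, ?_⟩, ?_, ?_⟩
  · rintro ⟨ψ₀, h1, hpos, hfix, -⟩
    exact ⟨ψ₀, hpos.mono fun _ hx => hx.le, liminf_of_groundState ψ₀ h1 hpos hfix ψ₀
      (Lp.nonneg_of_ae_pos hpos) fun h0 => by simp [h0] at h1⟩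
  · rintro ⟨ψ, hψ, h⟩
    exact hS.exists_groundState_of_liminf_pos ht₀ himp ((Lp.coeFn_nonneg ψ).1 hψ) h
  · rintro ⟨ψ, hψ, h⟩ φ hφ hφ0
    obtain ⟨ψ₀, h1, hpos, hfix, -⟩ :=
      hS.exists_groundState_of_liminf_pos ht₀ himp ((Lp.coeFn_nonneg ψ).1 hψ) h
    refine liminf_of_groundState ψ₀ h1 hpos hfix φ ((Lp.coeFn_nonneg φ).1 hφ) fun h0 => ?_
    refine hφ0.ne' (measure_mono_null (fun x hx => ?_)
      (ae_iff.1 ((Lp.eq_zero_iff_ae_eq_zero).1 h0)))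
    exact ne_of_gt hx
  · intro h
    obtain ⟨f, hf⟩ : ∃ f : Lp ℝ 2 m, f ≠ 0 := by
      by_contra! h0
      have hle := (S 0).opNorm_le_bound le_rfl fun f => by simp [h0 f]
      rw [hnorm 0 le_rfl] at hle
      linarith
    refine ⟨|f|, (Lp.coeFn_nonneg _).2 (abs_nonneg f), h _ ((Lp.coeFn_nonneg _).2 (abs_nonneg f))
      (pos_iff_ne_zero.2 fun h0 => hf ?_)⟩
    rw [Lp.eq_zero_iff_ae_eq_zero]
    have hnonpos : ∀ᵐ x ∂m, ¬ 0 < |f| x := by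
      rw [ae_iff]
      simpa using h0
    filter_upwards [hnonpos, Lp.coeFn_abs f] with x hx hfx
    rw [hfx] at hx
    simpa using hx
end

section
/- Let μ be a probability measure on a measurable space, A a set with μ(A) > 0, and f, g nonnegative measurable functions with ∫_A f·g dμ ≥ (∫_A f dμ)(∫_A g dμ)/μ(A) whenever f, g are symmetric quasi-concave and μ is a centered Gaussian measure on a separable Banach space with A symmetric convex. Deduce: for ν(dx) = 1_A(x) μ(dx)/μ(A) the restricted measure, and f symmetric quasi-concave nonnegative, ∫ f dν ≥ ∫ f d(Π_{A'} ν) whenever A' ⊆ A is symmetric convex — equivalently, conditioning a centered Gaussian measure on nested symmetric convex sets only increases integrals of symmetric quasi-concave functions: ∫ f d(Π_{A}(μ)) ≥ ∫ f dμ. -/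
open MeasureTheory ProbabilityTheory

namespace GaussianCorrelation

open scoped Matrix ENNReal NNReal MatrixOrder

section Determinant

variable {ι : Type*} [Fintype ι] [DecidableEq ι]

lemma det_one_add_diagonal_mul (l : ι → ℝ) (C : Matrix ι ι ℝ) :
    (1 + Matrix.diagonal l * C).det =
      ∑ s : Finset ι, (∏ i ∈ s, l i) * (C.submatrix (↑) (↑) : Matrix s s ℝ).det := by
  have h := (Matrix.detRowAlternating : (ι → ℝ) [⋀^ι]→ₗ[ℝ] ℝ).map_add_univ
    (Matrix.diagonal l * C) (1 : Matrix ι ι ℝ)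
  rw [add_comm]
  refine h.trans (Finset.sum_congr rfl fun s _ => ?_)
  rw [← Matrix.det_piecewise_one_eq_submatrix_det]
  have h1 : (s.piecewise (Matrix.diagonal l * C) (1 : Matrix ι ι ℝ) : Matrix ι ι ℝ) =
      fun i => (if i ∈ s then l i else 1) • s.piecewise C.row (1 : Matrix ι ι ℝ).row i := by
    funext i j
    by_cases hi : i ∈ s
    · simp [Finset.piecewise, hi, Matrix.diagonal_mul, Matrix.row]
    · simp [Finset.piecewise, hi, Matrix.row]
  rw [h1]
  refine ((Matrix.detRowAlternating : (ι → ℝ) [⋀^ι]→ₗ[ℝ] ℝ).map_smul_univ _ _).trans ?_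
  rw [smul_eq_mul]
  congr 1
  simp [Finset.prod_ite_mem]

lemma one_le_det_one_add {M : Matrix ι ι ℝ} (hM : M.PosSemidef) : 1 ≤ (1 + M).det := by
  have h := det_one_add_diagonal_mul (fun _ => 1) M
  rw [show Matrix.diagonal (fun _ : ι => (1 : ℝ)) = 1 from Matrix.diagonal_one, one_mul] at h
  rw [h]
  refine le_trans ?_ (Finset.single_le_sum (f := fun s : Finset ι => (∏ i ∈ s, (1 : ℝ)) *
    (M.submatrix (↑) (↑) : Matrix s s ℝ).det) (fun s _ => ?_) (Finset.mem_univ ∅))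
  · simp
  · simpa using (hM.submatrix _).det_nonneg

lemma det_le_det_add {A B : Matrix ι ι ℝ} (hA : A.PosSemidef) (hB : B.PosSemidef) :
    A.det ≤ (A + B).det := by
  by_cases h : A.det = 0
  · rw [h]
    exact (hA.add hB).det_nonneg
  obtain ⟨R, rfl⟩ := CStarAlgebra.nonneg_iff_eq_star_mul_self.mp hA.nonneg
  have hR : IsUnit R.det := by
    rw [isUnit_iff_ne_zero]
    rintro h0
    exact h (by rw [Matrix.det_mul, h0, mul_zero])
  have h1 : star R * R + B = star R * (1 + (R⁻¹)ᴴ * B * R⁻¹) * R := by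
    have e1 : star R * (R⁻¹)ᴴ = 1 := by
      rw [Matrix.star_eq_conjTranspose, ← Matrix.conjTranspose_mul, Matrix.nonsing_inv_mul _ hR,
        Matrix.conjTranspose_one]
    calc star R * R + B = star R * R + 1 * B * 1 := by simp
      _ = star R * R + (star R * (R⁻¹)ᴴ) * B * (R⁻¹ * R) := by
        rw [e1, Matrix.nonsing_inv_mul _ hR]
      _ = _ := by noncomm_ring
  have h2 := one_le_det_one_add (hB.conjTranspose_mul_mul_same R⁻¹)
  have h3 : (0 : ℝ) ≤ (star R * R).det := hA.det_nonneg
  have h4 : (star R * (1 + (R⁻¹)ᴴ * B * R⁻¹) * R).det =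
      (star R * R).det * (1 + (R⁻¹)ᴴ * B * R⁻¹).det := by
    rw [Matrix.det_mul, Matrix.det_mul, Matrix.det_mul, mul_right_comm]
  rw [h1, h4]
  exact le_mul_of_one_le_right h3 h2

/-- The matrix `C` with the entries linking `p` and its complement multiplied by `t`. -/
def blockScale (p : ι → Prop) [DecidablePred p] (t : ℝ) (C : Matrix ι ι ℝ) : Matrix ι ι ℝ :=
  Matrix.of fun i j => if (p i ↔ p j) then C i j else t * C i j

omit [Fintype ι] [DecidableEq ι] in
lemma submatrix_blockScale (p : ι → Prop) [DecidablePred p] (t : ℝ) (C : Matrix ι ι ℝ)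
    {κ : Type*} (e : κ → ι) :
    (blockScale p t C).submatrix e e = blockScale (p ∘ e) t (C.submatrix e e) := rfl

lemma det_blockScale_le_of_posDef (p : ι → Prop) [DecidablePred p] {C : Matrix ι ι ℝ}
    (hC : C.PosDef) {s t : ℝ} (hs : 0 ≤ s) (hst : s ≤ t) (ht : t ≤ 1) :
    (blockScale p t C).det ≤ (blockScale p s C).det := by
  let e := Equiv.sumCompl p
  let N := C.submatrix e e
  have hN : N.PosDef := hC.submatrix e.injective
  let A := N.toBlocks₁₁
  let B := N.toBlocks₁₂
  let D := N.toBlocks₂₂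
  have hB : N.toBlocks₂₁ = Bᴴ := by
    ext i j
    have := congrFun (congrFun hN.1 (Sum.inr i)) (Sum.inl j)
    simpa [B, Matrix.toBlocks₂₁, Matrix.toBlocks₁₂] using this.symm
  have hA : A.PosDef := hN.submatrix Sum.inl_injective
  let _ : Invertible A := hA.isUnit.invertible
  have hN' : N = Matrix.fromBlocks A B Bᴴ D := by
    rw [← hB]; exact (Matrix.fromBlocks_toBlocks N).symm
  let Q := Bᴴ * A⁻¹ * B
  have hQ : Q.PosSemidef := hA.inv.posSemidef.conjTranspose_mul_mul_same B
  have hDQ : (D - Q).PosSemidef := by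
    rw [← Matrix.PosDef.fromBlocks₁₁ B D hA, ← hN']
    exact hN.posSemidef
  have key : ∀ r : ℝ, (blockScale p r C).det = A.det * (D - r ^ 2 • Q).det := by
    intro r
    rw [← Matrix.det_submatrix_equiv_self e]
    have : (blockScale p r C).submatrix e e = Matrix.fromBlocks A (r • B) (r • Bᴴ) D := by
      rw [← hB]
      ext (i | i) (j | j)
      · simp [blockScale, e, A, N, Matrix.toBlocks₁₁, i.2, j.2]
      · simp [blockScale, e, B, N, Matrix.toBlocks₁₂, i.2, j.2]
      · simp [blockScale, e, N, Matrix.toBlocks₂₁, i.2, j.2]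
      · simp [blockScale, e, D, N, Matrix.toBlocks₂₂, i.2, j.2]
    rw [this, Matrix.det_fromBlocks₁₁, Matrix.invOf_eq_nonsing_inv]
    congr 3
    simp [Q, smul_smul, sq]
  rw [key, key]
  refine mul_le_mul_of_nonneg_left ?_ hA.det_pos.le
  have hE : (D - t ^ 2 • Q).PosSemidef := by
    have h1 : D - t ^ 2 • Q = (D - Q) + (1 - t ^ 2) • Q := by
      rw [sub_smul, one_smul]; abel
    rw [h1]
    exact hDQ.add (hQ.smul (by nlinarith))
  have h2 : D - s ^ 2 • Q = (D - t ^ 2 • Q) + (t ^ 2 - s ^ 2) • Q := by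
    rw [sub_smul]; abel
  rw [h2]
  exact det_le_det_add hE (hQ.smul (by nlinarith))

lemma det_blockScale_le (p : ι → Prop) [DecidablePred p] {C : Matrix ι ι ℝ}
    (hC : C.PosSemidef) {s t : ℝ} (hs : 0 ≤ s) (hst : s ≤ t) (ht : t ≤ 1) :
    (blockScale p t C).det ≤ (blockScale p s C).det := by
  have hcont : ∀ r : ℝ, Continuous fun ε : ℝ => (blockScale p r (C + ε • 1)).det := by
    intro r
    refine Continuous.matrix_det ?_
    refine continuous_matrix fun i j => ?_
    simp only [blockScale, Matrix.of_apply, Matrix.add_apply, Matrix.smul_apply, smul_eq_mul]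
    split_ifs <;> fun_prop
  have hlim : ∀ r : ℝ, Filter.Tendsto (fun ε : ℝ => (blockScale p r (C + ε • 1)).det)
      (nhdsWithin 0 (Set.Ioi 0)) (nhds (blockScale p r C).det) := by
    intro r
    have := ((hcont r).tendsto 0).mono_left (nhdsWithin_le_nhds (s := Set.Ioi 0))
    simpa using this
  refine le_of_tendsto_of_tendsto (hlim t) (hlim s) ?_
  filter_upwards [self_mem_nhdsWithin] with ε hε
  refine det_blockScale_le_of_posDef p ?_ hs hst ht
  exact (Matrix.PosDef.posSemidef_add hC (Matrix.PosDef.one.smul hε))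

end Determinant

section Laplace

variable {κ : Type*} [Fintype κ]

lemma integral_exp_neg_mul_sq_gaussianReal {a : ℝ} (ha : 0 ≤ a) :
    ∫ x, Real.exp (-(a * x ^ 2)) ∂gaussianReal 0 1 = (√(1 + 2 * a))⁻¹ := by
  rw [integral_gaussianReal_eq_integral_smul one_ne_zero]
  have h : ∀ x : ℝ, gaussianPDFReal 0 1 x • Real.exp (-(a * x ^ 2)) =
      (√(2 * Real.pi))⁻¹ * Real.exp (-(a + 1 / 2) * x ^ 2) := by
    intro x
    simp only [gaussianPDFReal, NNReal.coe_one, smul_eq_mul, mul_assoc, ← Real.exp_add]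
    congr 2
    · simp
    · ring_nf
  simp_rw [h]
  rw [integral_const_mul, integral_gaussian, ← Real.sqrt_inv, ← Real.sqrt_inv,
    ← Real.sqrt_mul (by positivity)]
  congr 1
  have := Real.pi_pos
  field_simp
  ring

variable [DecidableEq κ]

lemma det_one_add_two_smul {M : Matrix κ κ ℝ} (hM : M.IsHermitian) :
    (1 + (2 : ℝ) • M).det = ∏ i, (1 + 2 * hM.eigenvalues i) := by
  have h : (2 : ℝ) • M = (hM.eigenvectorUnitary : Matrix κ κ ℝ) *
      (Matrix.diagonal (fun i => 2 * hM.eigenvalues i) *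
        star (hM.eigenvectorUnitary : Matrix κ κ ℝ)) := by
    conv_lhs => rw [hM.spectral_theorem, Unitary.conjStarAlgAut_apply]
    rw [← mul_assoc, ← smul_mul_assoc, ← mul_smul_comm, ← Matrix.diagonal_smul]
    rfl
  rw [h, Matrix.det_one_add_mul_comm, mul_assoc, Unitary.coe_star_mul_self, mul_one,
    ← Matrix.diagonal_one, Matrix.diagonal_add, Matrix.det_diagonal]

lemma integral_exp_neg_quadratic {M : Matrix κ κ ℝ} (hM : M.PosSemidef) :
    ∫ x, Real.exp (-(x ⬝ᵥ M *ᵥ x)) ∂(Measure.pi fun _ : κ => gaussianReal 0 1) =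
      (√(1 + (2 : ℝ) • M).det)⁻¹ := by
  have hH := hM.isHermitian
  let b := hH.eigenvectorBasis
  let γ := Measure.pi fun _ : κ => gaussianReal 0 1
  have hlaw : γ.map (WithLp.toLp 2) = γ.map (fun x : κ → ℝ => ∑ i, x i • b i) := by
    rw [map_pi_eq_stdGaussian, stdGaussian_eq_map_pi_orthonormalBasis b]
  have hF : Continuous fun y : EuclideanSpace ℝ κ =>
      Real.exp (-(y.ofLp ⬝ᵥ M *ᵥ y.ofLp)) := by
    simp only [dotProduct, Matrix.mulVec]
    fun_prop
  have hsum : Measurable fun x : κ → ℝ => ∑ i, x i • b i :=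
    (continuous_finsetSum _ fun i _ => by fun_prop).measurable
  have h1 : ∫ x, Real.exp (-(x ⬝ᵥ M *ᵥ x)) ∂γ =
      ∫ y, Real.exp (-(y.ofLp ⬝ᵥ M *ᵥ y.ofLp)) ∂(γ.map (WithLp.toLp 2)) := by
    rw [integral_map (by fun_prop) hF.aestronglyMeasurable]
  have h2 : ∀ x : κ → ℝ, (∑ i, x i • b i).ofLp ⬝ᵥ M *ᵥ (∑ i, x i • b i).ofLp =
      ∑ i, hH.eigenvalues i * x i ^ 2 := by
    intro x
    have e1 : M *ᵥ (∑ i, x i • b i).ofLp =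
        (∑ i, (x i * hH.eigenvalues i) • b i).ofLp := by
      simp only [WithLp.ofLp_sum, Matrix.mulVec_sum, WithLp.ofLp_smul, Matrix.mulVec_smul]
      refine Finset.sum_congr rfl fun i _ => ?_
      rw [hH.mulVec_eigenvectorBasis, smul_smul]
    rw [e1]
    have e2 := b.orthonormal.inner_sum (fun i => x i * hH.eigenvalues i) x Finset.univ
    rw [EuclideanSpace.inner_eq_star_dotProduct] at e2
    simp only [star_trivial, conj_trivial] at e2
    rw [e2]
    exact Finset.sum_congr rfl fun i _ => by ring
  change ∫ x, Real.exp (-(x ⬝ᵥ M *ᵥ x)) ∂γ = _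
  rw [h1, hlaw, integral_map hsum.aemeasurable hF.aestronglyMeasurable]
  simp_rw [h2, ← Finset.sum_neg_distrib, Real.exp_sum]
  rw [integral_fintype_prod_eq_prod (fun i x => Real.exp (-(hH.eigenvalues i * x ^ 2)))]
  simp_rw [integral_exp_neg_mul_sq_gaussianReal (hM.eigenvalues_nonneg _)]
  rw [det_one_add_two_smul hH, Finset.prod_inv_distrib, Real.sqrt_prod]
  exact fun i _ => by have := hM.eigenvalues_nonneg i; positivity

variable {ι : Type*} [Fintype ι] [DecidableEq ι]

lemma lintegral_exp_neg_sum_mul_sq (S : Matrix ι κ ℝ) {l : ι → ℝ} (hl : ∀ i, 0 ≤ l i) :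
    ∫⁻ x, ENNReal.ofReal (Real.exp (-∑ i, l i * (S *ᵥ x) i ^ 2))
      ∂(Measure.pi fun _ : κ => gaussianReal 0 1) =
      ENNReal.ofReal (√(1 + Matrix.diagonal l * ((2 : ℝ) • (S * Sᵀ))).det)⁻¹ := by
  have hM : (Sᵀ * Matrix.diagonal l * S).PosSemidef := by
    simpa using (Matrix.PosSemidef.diagonal (d := l) hl).conjTranspose_mul_mul_same S
  have hq : ∀ x : κ → ℝ, x ⬝ᵥ (Sᵀ * Matrix.diagonal l * S) *ᵥ x =
      ∑ i, l i * (S *ᵥ x) i ^ 2 := by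
    intro x
    rw [← Matrix.mulVec_mulVec, ← Matrix.mulVec_mulVec, Matrix.dotProduct_mulVec,
      Matrix.vecMul_transpose]
    simp only [dotProduct, Matrix.mulVec_diagonal]
    exact Finset.sum_congr rfl fun i _ => by ring
  simp_rw [← hq]
  rw [← ofReal_integral_eq_lintegral_ofReal, integral_exp_neg_quadratic hM]
  · congr 4
    rw [Matrix.mul_assoc, ← Matrix.mul_smul, Matrix.det_one_add_mul_comm, Matrix.smul_mul,
      Matrix.mul_assoc, Matrix.mul_smul]
  · refine Integrable.of_bound (C := 1) ?_ (ae_of_all _ fun x => ?_)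
    · refine Continuous.aestronglyMeasurable ?_
      simp only [dotProduct, Matrix.mulVec]
      fun_prop
    · rw [Real.norm_eq_abs, abs_of_pos (Real.exp_pos _), hq, Real.exp_le_one_iff]
      simp only [Left.neg_nonpos_iff]
      exact Finset.sum_nonneg fun i _ => mul_nonneg (hl i) (sq_nonneg _)
  · exact ae_of_all _ fun x => (Real.exp_pos _).le

end Laplace

section LaplaceUniqueness

open BoundedContinuousFunction

variable {ι : Type*} [Fintype ι]

/-- The exponential `x ↦ exp (-∑ i, k i * x i)` as a bounded continuous function on the orthant. -/
noncomputable def expNeg (k : ι → ℕ) : (ι → ℝ≥0) →ᵇ ℝ :=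
  BoundedContinuousFunction.ofNormedAddCommGroup
    (fun x => Real.exp (-∑ i, (k i : ℝ) * x i)) (by fun_prop) 1 fun x => by
      rw [Real.norm_eq_abs, abs_of_pos (Real.exp_pos _), Real.exp_le_one_iff]
      simp only [Left.neg_nonpos_iff]
      positivity

lemma expNeg_apply (k : ι → ℕ) (x : ι → ℝ≥0) :
    expNeg k x = Real.exp (-∑ i, (k i : ℝ) * x i) := rfl

/-- The exponentials `expNeg k`, as a submonoid. -/
noncomputable def expNegSubmonoid (ι : Type*) [Fintype ι] : Submonoid ((ι → ℝ≥0) →ᵇ ℝ) where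
  carrier := Set.range expNeg
  mul_mem' := by
    rintro _ _ ⟨k, rfl⟩ ⟨l, rfl⟩
    refine ⟨k + l, ?_⟩
    ext x
    simp [expNeg_apply, ← Real.exp_add, add_mul, Finset.sum_add_distrib, add_comm]
  one_mem' := ⟨0, by ext x; simp [expNeg_apply]⟩

/-- The star subalgebra spanned by the exponentials `expNeg k`. -/
noncomputable def expNegAlgebra (ι : Type*) [Fintype ι] : StarSubalgebra ℝ ((ι → ℝ≥0) →ᵇ ℝ) where
  toSubalgebra := Algebra.adjoin ℝ (expNegSubmonoid ι : Set ((ι → ℝ≥0) →ᵇ ℝ))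
  star_mem' := by
    intro a ha
    have : star a = a := by ext x; simp
    rwa [this]

lemma ext_of_integral_expNeg {P P' : Measure (ι → ℝ≥0)} [IsFiniteMeasure P] [IsFiniteMeasure P']
    (h : ∀ k : ι → ℕ, ∫ x, expNeg k x ∂P = ∫ x, expNeg k x ∂P') : P = P' := by
  classical
  refine ext_of_forall_mem_subalgebra_integral_eq_of_polish (𝕜 := ℝ) (A := expNegAlgebra ι) ?_ ?_
  · intro x y hxy
    obtain ⟨i, hi⟩ := Function.ne_iff.mp hxy
    have hmem : expNeg (Pi.single i 1) ∈ expNegAlgebra ι :=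
      Algebra.subset_adjoin ⟨Pi.single i 1, rfl⟩
    refine ⟨_, ⟨_, ⟨_, hmem, rfl⟩, rfl⟩, ?_⟩
    change expNeg (Pi.single i 1) x ≠ expNeg (Pi.single i 1) y
    intro h0
    rw [expNeg_apply, expNeg_apply, Real.exp_eq_exp] at h0
    simp [Pi.single_apply] at h0
    exact hi h0
  · intro g hg
    have hg' : g ∈ Submodule.span ℝ (expNegSubmonoid ι : Set ((ι → ℝ≥0) →ᵇ ℝ)) := by
      have hg2 : g ∈ Algebra.adjoin ℝ (expNegSubmonoid ι : Set ((ι → ℝ≥0) →ᵇ ℝ)) := hg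
      rwa [← Subalgebra.mem_toSubmodule, Algebra.adjoin_eq_span, Submonoid.closure_eq] at hg2
    clear hg
    induction hg' using Submodule.span_induction with
    | mem f hf =>
      obtain ⟨k, rfl⟩ := hf
      exact h k
    | zero => simp
    | add f f' _ _ hf hf' =>
      have e : ∀ Q : Measure (ι → ℝ≥0), [IsFiniteMeasure Q] →
          ∫ x, (f + f') x ∂Q = ∫ x, f x ∂Q + ∫ x, f' x ∂Q := fun Q _ =>
        integral_add (f.integrable Q) (f'.integrable Q)
      rw [e, e, hf, hf']
    | smul c f _ hf =>
      have e : ∀ Q : Measure (ι → ℝ≥0), [IsFiniteMeasure Q] →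
          ∫ x, (c • f) x ∂Q = c * ∫ x, f x ∂Q := fun Q _ => integral_const_mul c _
      rw [e, e, hf]

lemma ext_of_lintegral_exp_neg_nnreal {M N : Measure (ι → ℝ≥0)}
    (hfin : ∫⁻ x, ENNReal.ofReal (Real.exp (-∑ i, (x i : ℝ))) ∂M ≠ ∞)
    (h : ∀ k : ι → ℕ, (∀ i, 1 ≤ k i) →
      ∫⁻ x, ENNReal.ofReal (Real.exp (-∑ i, (k i : ℝ) * x i)) ∂M =
        ∫⁻ x, ENNReal.ofReal (Real.exp (-∑ i, (k i : ℝ) * x i)) ∂N) : M = N := by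
  let w : (ι → ℝ≥0) → ℝ≥0∞ := fun x => ENNReal.ofReal (Real.exp (-∑ i, (x i : ℝ)))
  have hw : Measurable w := by fun_prop
  have hfinN : ∫⁻ x, w x ∂N ≠ ∞ := by
    have := h (fun _ => 1) fun _ => le_rfl
    simp only [Nat.cast_one, one_mul] at this
    rwa [this] at hfin
  have hM : IsFiniteMeasure (M.withDensity w) := isFiniteMeasure_withDensity hfin
  have hN : IsFiniteMeasure (N.withDensity w) := isFiniteMeasure_withDensity hfinN
  have hint : ∀ (Q : Measure (ι → ℝ≥0)) (k : ι → ℕ), ∫ x, expNeg k x ∂(Q.withDensity w) =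
      (∫⁻ x, ENNReal.ofReal (Real.exp (-∑ i, ((k i + 1 : ℕ) : ℝ) * x i)) ∂Q).toReal := by
    intro Q k
    rw [integral_eq_lintegral_of_nonneg_ae (f := fun x => expNeg k x)
      (ae_of_all _ fun x => (Real.exp_pos _).le) (expNeg k).continuous.aestronglyMeasurable,
      lintegral_withDensity_eq_lintegral_mul _ hw (by fun_prop)]
    congr 2
    ext x
    simp only [Pi.mul_apply, w, expNeg_apply]
    rw [← ENNReal.ofReal_mul (Real.exp_pos _).le, ← Real.exp_add]
    congr 2
    simp [add_mul, Finset.sum_add_distrib]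
  have key : M.withDensity w = N.withDensity w := by
    refine ext_of_integral_expNeg fun k => ?_
    rw [hint, hint, h (fun i => k i + 1) fun i => by omega]
  have hne0 : ∀ x, w x ≠ 0 := fun x => by
    simp only [w, ne_eq, ENNReal.ofReal_eq_zero, not_le]; exact Real.exp_pos _
  rw [← withDensity_inv_same (μ := M) hw (ae_of_all _ hne0) (ae_of_all _ fun x =>
      ENNReal.ofReal_ne_top), key,
    withDensity_inv_same hw (ae_of_all _ hne0) (ae_of_all _ fun x => ENNReal.ofReal_ne_top)]

/-- Measures on the nonnegative orthant are determined by their Laplace transforms. -/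
lemma ext_of_lintegral_exp_neg {M N : Measure (ι → ℝ)} (hM0 : ∀ᵐ x ∂M, ∀ i, 0 ≤ x i)
    (hN0 : ∀ᵐ x ∂N, ∀ i, 0 ≤ x i)
    (hfin : ∫⁻ x, ENNReal.ofReal (Real.exp (-∑ i, x i)) ∂M ≠ ∞)
    (h : ∀ l : ι → ℝ, (∀ i, 0 < l i) →
      ∫⁻ x, ENNReal.ofReal (Real.exp (-∑ i, l i * x i)) ∂M =
        ∫⁻ x, ENNReal.ofReal (Real.exp (-∑ i, l i * x i)) ∂N) : M = N := by
  let f : (ι → ℝ) → ι → ℝ≥0 := fun x i => (x i).toNNReal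
  let g : (ι → ℝ≥0) → ι → ℝ := fun x i => x i
  have hf : Measurable f := by fun_prop
  have hg : Measurable g := by fun_prop
  have hgf : ∀ Q : Measure (ι → ℝ), (∀ᵐ x ∂Q, ∀ i, 0 ≤ x i) → (Q.map f).map g = Q := by
    intro Q hQ
    rw [Measure.map_map hg hf, Measure.map_congr (g := id), Measure.map_id]
    filter_upwards [hQ] with x hx
    ext i
    exact Real.coe_toNNReal _ (hx i)
  have hl : ∀ Q : Measure (ι → ℝ), (∀ᵐ x ∂Q, ∀ i, 0 ≤ x i) → ∀ l : ι → ℝ,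
      ∫⁻ x, ENNReal.ofReal (Real.exp (-∑ i, l i * x i)) ∂(Q.map f) =
        ∫⁻ x, ENNReal.ofReal (Real.exp (-∑ i, l i * x i)) ∂Q := by
    intro Q hQ l
    rw [lintegral_map (by fun_prop) hf]
    refine lintegral_congr_ae ?_
    filter_upwards [hQ] with x hx
    simp only [f, Real.coe_toNNReal _ (hx _)]
  rw [← hgf M hM0, ← hgf N hN0]
  congr 1
  refine ext_of_lintegral_exp_neg_nnreal ?_ fun k hk => ?_
  · have := hl M hM0 fun _ => 1
    simp only [one_mul] at this
    rwa [this]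
  · rw [hl M hM0 fun i => (k i : ℝ), hl N hN0 fun i => (k i : ℝ)]
    exact h _ fun i => by exact_mod_cast hk i

end LaplaceUniqueness

section Interpolation

variable {ι κ : Type*} [Fintype ι] [DecidableEq ι] [Fintype κ]

/-- A matrix `S` with `S * Sᵀ = blockScale p t (T * Tᵀ)`. -/
noncomputable def blockRoot (p : ι → Prop) [DecidablePred p] (T : Matrix ι κ ℝ) (t : ℝ) :
    Matrix ι (κ ⊕ κ) ℝ :=
  Matrix.of fun i => Sum.elim (fun k => if p i then T i k else t * T i k)
    fun k => if p i then 0 else √(1 - t ^ 2) * T i k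

omit [Fintype ι] [DecidableEq ι] in
lemma blockRoot_mul_transpose (p : ι → Prop) [DecidablePred p] (T : Matrix ι κ ℝ) {t : ℝ}
    (h0 : 0 ≤ t) (h1 : t ≤ 1) :
    blockRoot p T t * (blockRoot p T t)ᵀ = blockScale p t (T * Tᵀ) := by
  have hs : √(1 - t ^ 2) * √(1 - t ^ 2) = 1 - t ^ 2 := Real.mul_self_sqrt (by nlinarith)
  ext i j
  simp only [Matrix.mul_apply, blockRoot, blockScale, Matrix.transpose_apply, Matrix.of_apply,
    Fintype.sum_sum_type, Sum.elim_inl, Sum.elim_inr]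
  by_cases hi : p i <;> by_cases hj : p j <;>
    simp only [hi, hj, if_true, if_false, iff_self, iff_true, iff_false, not_true,
      mul_zero, zero_mul, Finset.sum_const_zero, add_zero, Finset.mul_sum,
      ← Finset.sum_add_distrib]
  · exact Finset.sum_congr rfl fun k _ => by ring
  · exact Finset.sum_congr rfl fun k _ => by ring
  · exact Finset.sum_congr rfl fun k _ => by linear_combination T i k * T j k * hs

omit [DecidableEq ι] in
lemma posSemidef_blockScale (p : ι → Prop) [DecidablePred p] (T : Matrix ι κ ℝ) {t : ℝ}
    (h0 : 0 ≤ t) (h1 : t ≤ 1) : (blockScale p t (T * Tᵀ)).PosSemidef := by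
  rw [← blockRoot_mul_transpose p T h0 h1]
  exact Matrix.posSemidef_self_mul_conjTranspose _

/-- The principal minor of `2 • blockScale p t C` with rows in `s`. -/
noncomputable def blockMinor (p : ι → Prop) [DecidablePred p] (C : Matrix ι ι ℝ) (s : Finset ι)
    (t : ℝ) : ℝ :=
  (((2 : ℝ) • blockScale p t C).submatrix (↑) (↑) : Matrix s s ℝ).det

omit [Fintype ι] in
lemma contDiff_blockMinor (p : ι → Prop) [DecidablePred p] (C : Matrix ι ι ℝ) (s : Finset ι) :
    ContDiff ℝ 1 (blockMinor p C s) := by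
  unfold blockMinor
  simp only [Matrix.det_apply']
  refine ContDiff.sum fun σ _ => contDiff_const.mul (contDiff_prod fun i _ => ?_)
  simp only [Matrix.submatrix_apply, Matrix.smul_apply, blockScale, Matrix.of_apply]
  split_ifs <;> fun_prop

omit [Fintype ι] in
lemma deriv_blockMinor_nonpos (p : ι → Prop) [DecidablePred p] {C : Matrix ι ι ℝ}
    (hC : C.PosSemidef) (s : Finset ι) {t : ℝ} (ht : t ∈ Set.Ioo (0 : ℝ) 1) :
    deriv (blockMinor p C s) t ≤ 0 := by
  have h : AntitoneOn (blockMinor p C s) (Set.Icc 0 1) := by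
    intro a ha b hb hab
    simp only [blockMinor, Matrix.submatrix_smul, Pi.smul_apply, Matrix.det_smul,
      submatrix_blockScale]
    exact mul_le_mul_of_nonneg_left
      (det_blockScale_le _ (hC.submatrix _) ha.1 hab hb.2) (by positivity)
  rw [← derivWithin_of_mem_nhds (Icc_mem_nhds ht.1 ht.2)]
  exact h.derivWithin_nonpos

/-- The determinant governing the Laplace transform along the interpolation. -/
noncomputable def pathDet (p : ι → Prop) [DecidablePred p] (C : Matrix ι ι ℝ) (l : ι → ℝ) (t : ℝ) :
    ℝ :=
  (1 + Matrix.diagonal l * ((2 : ℝ) • blockScale p t C)).det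

lemma pathDet_eq_sum (p : ι → Prop) [DecidablePred p] (C : Matrix ι ι ℝ) (l : ι → ℝ) :
    pathDet p C l = fun t => ∑ s : Finset ι, (∏ i ∈ s, l i) * blockMinor p C s t := by
  ext t
  exact det_one_add_diagonal_mul _ _

lemma one_le_pathDet (p : ι → Prop) [DecidablePred p] (T : Matrix ι κ ℝ) {l : ι → ℝ}
    (hl : ∀ i, 0 ≤ l i) {t : ℝ} (h0 : 0 ≤ t) (h1 : t ≤ 1) : 1 ≤ pathDet p (T * Tᵀ) l t := by
  rw [pathDet_eq_sum]
  have hnn : ∀ s, 0 ≤ (∏ i ∈ s, l i) * blockMinor p (T * Tᵀ) s t := fun s =>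
    mul_nonneg (Finset.prod_nonneg fun i _ => hl i)
      (((posSemidef_blockScale p T h0 h1).smul zero_le_two).submatrix _).det_nonneg
  refine le_trans ?_ (Finset.single_le_sum (fun s _ => hnn s) (Finset.mem_univ ∅))
  simp [blockMinor]

lemma ofReal_inv_sqrt_pathDet (p : ι → Prop) [DecidablePred p] (T : Matrix ι κ ℝ) {l : ι → ℝ}
    (hl : ∀ i, 0 ≤ l i) :
    ENNReal.ofReal (√(pathDet p (T * Tᵀ) l 1))⁻¹ =
      ENNReal.ofReal (√(pathDet p (T * Tᵀ) l 0))⁻¹ +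
        ∑ s : Finset ι, ENNReal.ofReal (∏ i ∈ s, l i) * ∫⁻ t in Set.Ioo (0 : ℝ) 1,
          ENNReal.ofReal (-deriv (blockMinor p (T * Tᵀ) s) t / 2) *
            ENNReal.ofReal (√(pathDet p (T * Tᵀ) l t))⁻¹ ^ 3 := by
  set C := T * Tᵀ with hC
  have hCp : C.PosSemidef := Matrix.posSemidef_self_mul_conjTranspose _
  let D := pathDet p C l
  let c : Finset ι → ℝ → ℝ := fun s t => -deriv (blockMinor p C s) t / 2
  have hc : ∀ s, Continuous (c s) := fun s =>
    ((contDiff_blockMinor p C s).continuous_deriv le_rfl).neg.div_const 2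
  have hDcont : Continuous D := by
    change Continuous (pathDet p C l)
    rw [pathDet_eq_sum]
    exact continuous_finsetSum _ fun s _ => (contDiff_blockMinor p C s).continuous.const_mul _
  have hD1 : ∀ t ∈ Set.Icc (0 : ℝ) 1, 1 ≤ D t := fun t ht => one_le_pathDet p T hl ht.1 ht.2
  let G : ℝ → ℝ := fun t => ∑ s : Finset ι, (∏ i ∈ s, l i) * (c s t * (√(D t))⁻¹ ^ 3)
  have hder : ∀ t ∈ Set.Icc (0 : ℝ) 1, HasDerivAt (fun t => (√(D t))⁻¹) (G t) t := by
    intro t ht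
    have hpos : 0 < D t := one_pos.trans_le (hD1 t ht)
    have h1 : HasDerivAt D (∑ s : Finset ι, (∏ i ∈ s, l i) * deriv (blockMinor p C s) t) t := by
      change HasDerivAt (pathDet p C l) _ t
      rw [pathDet_eq_sum]
      exact HasDerivAt.fun_sum fun s _ =>
        (((contDiff_blockMinor p C s).differentiable one_ne_zero) t).hasDerivAt.const_mul _
    refine ((h1.sqrt hpos.ne').fun_inv (Real.sqrt_pos.mpr hpos).ne').congr_deriv ?_
    symm
    change ∑ s : Finset ι, (∏ i ∈ s, l i) * (c s t * (√(D t))⁻¹ ^ 3) = _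
    rw [Finset.sum_div, ← Finset.sum_neg_distrib, Finset.sum_div]
    refine Finset.sum_congr rfl fun s _ => ?_
    have := Real.sqrt_pos.mpr hpos
    simp only [c]
    field_simp
  have hGcont : ContinuousOn G (Set.Icc 0 1) := by
    refine continuousOn_finsetSum _ fun s _ => continuousOn_const.mul
      ((hc s).continuousOn.mul (ContinuousOn.pow (ContinuousOn.inv₀ ?_ ?_) 3))
    · exact (Real.continuous_sqrt.comp hDcont).continuousOn
    · exact fun t ht => (Real.sqrt_pos.mpr (one_pos.trans_le (hD1 t ht))).ne'
  have hint : IntervalIntegrable G volume 0 1 :=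
    ContinuousOn.intervalIntegrable (by rwa [Set.uIcc_of_le zero_le_one])
  have hftc := intervalIntegral.integral_eq_sub_of_hasDerivAt
    (by rwa [Set.uIcc_of_le (zero_le_one (α := ℝ))]) hint
  rw [intervalIntegral.integral_of_le zero_le_one, integral_Ioc_eq_integral_Ioo] at hftc
  have hterm : ∀ s, ∀ t ∈ Set.Ioo (0 : ℝ) 1, 0 ≤ c s t := fun s t ht => by
    have := deriv_blockMinor_nonpos p hCp s ht
    simp only [c]
    linarith
  have hGnn : ∀ t ∈ Set.Ioo (0 : ℝ) 1, 0 ≤ G t := fun t ht =>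
    Finset.sum_nonneg fun s _ => mul_nonneg (Finset.prod_nonneg fun i _ => hl i)
      (mul_nonneg (hterm s t ht) (by positivity))
  have hGint : Integrable G (volume.restrict (Set.Ioo 0 1)) :=
    ((intervalIntegrable_iff_integrableOn_Ioc_of_le zero_le_one).mp hint).mono_set
      Set.Ioo_subset_Ioc_self
  have hnn : 0 ≤ ∫ t in Set.Ioo (0 : ℝ) 1, G t := setIntegral_nonneg measurableSet_Ioo hGnn
  rw [show (√(D 1))⁻¹ = (√(D 0))⁻¹ + ∫ t in Set.Ioo (0 : ℝ) 1, G t by rw [hftc]; ring,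
    ENNReal.ofReal_add (by positivity) hnn, ofReal_integral_eq_lintegral_ofReal hGint
      ((ae_restrict_iff' measurableSet_Ioo).mpr (ae_of_all _ hGnn))]
  congr 1
  have hm : ∀ s, Measurable fun t => ENNReal.ofReal (c s t) * ENNReal.ofReal (√(D t))⁻¹ ^ 3 :=
    fun s => (hc s).measurable.ennreal_ofReal.mul
      ((Real.continuous_sqrt.comp hDcont).measurable.inv.ennreal_ofReal.pow_const 3)
  trans ∑ s : Finset ι, ∫⁻ t in Set.Ioo (0 : ℝ) 1, ENNReal.ofReal (∏ i ∈ s, l i) *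
      (ENNReal.ofReal (c s t) * ENNReal.ofReal (√(D t))⁻¹ ^ 3)
  swap
  · exact Finset.sum_congr rfl fun s _ => lintegral_const_mul _ (hm s)
  rw [← lintegral_finsetSum _ fun s _ => (hm s).const_mul _]
  refine setLIntegral_congr_fun measurableSet_Ioo fun t ht => ?_
  simp only [G]
  rw [ENNReal.ofReal_sum_of_nonneg fun s _ => mul_nonneg (Finset.prod_nonneg fun i _ => hl i)
      (mul_nonneg (hterm s t ht) (by positivity))]
  refine Finset.sum_congr rfl fun s _ => ?_
  rw [ENNReal.ofReal_mul (Finset.prod_nonneg fun i _ => hl i), ENNReal.ofReal_mul (hterm s t ht),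
    ENNReal.ofReal_pow (by positivity)]

end Interpolation

section SquareLaw

variable {ι κ κ' : Type*} [Fintype ι] [DecidableEq ι] [Fintype κ] [Fintype κ']

/-- The standard Gaussian measure on `κ → ℝ`. -/
noncomputable abbrev stdGauss (κ : Type*) [Fintype κ] : Measure (κ → ℝ) :=
  Measure.pi fun _ => gaussianReal 0 1

/-- The law of the squares of the coordinates of the Gaussian vector `S *ᵥ x`. -/
noncomputable def sqLaw (S : Matrix ι κ ℝ) : Measure (ι → ℝ) :=
  (stdGauss κ).map fun x i => (S *ᵥ x) i ^ 2

omit [Fintype ι] [DecidableEq ι] in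
lemma measurable_mulVec_sq (S : Matrix ι κ ℝ) :
    Measurable fun (x : κ → ℝ) i => (S *ᵥ x) i ^ 2 := by
  simp only [Matrix.mulVec, dotProduct]
  fun_prop

instance (S : Matrix ι κ ℝ) : IsProbabilityMeasure (sqLaw S) :=
  Measure.isProbabilityMeasure_map (measurable_mulVec_sq S).aemeasurable

omit [DecidableEq ι] in
lemma ae_nonneg_sqLaw (S : Matrix ι κ ℝ) : ∀ᵐ x ∂sqLaw S, ∀ i, 0 ≤ x i := by
  rw [sqLaw, ae_map_iff (measurable_mulVec_sq S).aemeasurable]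
  · exact ae_of_all _ fun x i => sq_nonneg _
  · simp only [measurableSet_setOfPred]; fun_prop

lemma lintegral_exp_neg_sqLaw (S : Matrix ι κ ℝ) {l : ι → ℝ} (hl : ∀ i, 0 ≤ l i) :
    ∫⁻ x, ENNReal.ofReal (Real.exp (-∑ i, l i * x i)) ∂sqLaw S =
      ENNReal.ofReal (√(1 + Matrix.diagonal l * ((2 : ℝ) • (S * Sᵀ))).det)⁻¹ := by
  classical
  rw [sqLaw, lintegral_map (by fun_prop) (measurable_mulVec_sq S)]
  exact lintegral_exp_neg_sum_mul_sq S hl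

omit [DecidableEq ι] in
lemma sqLaw_congr {S : Matrix ι κ ℝ} {S' : Matrix ι κ' ℝ} (h : S * Sᵀ = S' * S'ᵀ) :
    sqLaw S = sqLaw S' := by
  classical
  refine ext_of_lintegral_exp_neg (ae_nonneg_sqLaw S) (ae_nonneg_sqLaw S') ?_ fun l hl => ?_
  · have := lintegral_exp_neg_sqLaw S (l := fun _ => 1) fun _ => zero_le_one
    simp only [one_mul] at this
    exact this ▸ ENNReal.ofReal_ne_top
  · rw [lintegral_exp_neg_sqLaw S fun i => (hl i).le, lintegral_exp_neg_sqLaw S' fun i => (hl i).le,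
      h]

/-- A coordinate of `orthantMeasure`. -/
noncomputable def orthantFactor (s : Finset ι) (i : ι) : Measure ℝ :=
  if i ∈ s then Measure.dirac 0 else volume.restrict (Set.Ici 0)

instance (s : Finset ι) (i : ι) : SigmaFinite (orthantFactor s i) := by
  unfold orthantFactor
  split_ifs <;> infer_instance

/-- Lebesgue measure on the face of the nonnegative orthant where the coordinates in `s` vanish. -/
noncomputable def orthantMeasure (s : Finset ι) : Measure (ι → ℝ) :=
  Measure.pi (orthantFactor s)

instance (s : Finset ι) : SigmaFinite (orthantMeasure s) := by
  unfold orthantMeasure; infer_instance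

lemma ae_nonneg_orthantMeasure (s : Finset ι) : ∀ᵐ x ∂orthantMeasure s, ∀ i, 0 ≤ x i := by
  refine ae_all_iff.mpr fun i => Measure.tendsto_eval_ae_ae.eventually (p := fun y : ℝ => 0 ≤ y) ?_
  unfold orthantFactor
  split_ifs
  · simp [ae_dirac_eq]
  · exact ae_restrict_mem measurableSet_Ici

lemma lintegral_exp_neg_orthantMeasure (s : Finset ι) {l : ι → ℝ} (hl : ∀ i, 0 < l i) :
    ∫⁻ x, ENNReal.ofReal (Real.exp (-∑ i, l i * x i)) ∂orthantMeasure s =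
      ENNReal.ofReal (∏ i ∈ sᶜ, (l i)⁻¹) := by
  have hi : ∀ i, Integrable (fun y => Real.exp (-(l i * y))) (orthantFactor s i) := by
    intro i
    unfold orthantFactor
    split_ifs
    · exact integrable_dirac (by simp)
    · have := integrableOn_exp_mul_Ioi (a := -l i) (by simpa using hl i) 0
      rw [← IntegrableOn, integrableOn_Ici_iff_integrableOn_Ioi]
      simpa using this
  have hv : ∀ i, ∫ y, Real.exp (-(l i * y)) ∂orthantFactor s i = if i ∈ s then 1 else (l i)⁻¹ := by
    intro i
    unfold orthantFactor
    split_ifs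
    · simp
    · have := integral_exp_mul_Ioi (a := -l i) (by simpa using hl i) 0
      rw [integral_Ici_eq_integral_Ioi]
      simp only [neg_mul] at this
      rw [this]
      simp
  simp_rw [← Finset.sum_neg_distrib, Real.exp_sum]
  rw [orthantMeasure, ← ofReal_integral_eq_lintegral_ofReal (Integrable.fintype_prod hi)
    (ae_of_all _ fun x => Finset.prod_nonneg fun i _ => (Real.exp_pos _).le),
    integral_fintype_prod_eq_prod (f := fun i y => Real.exp (-(l i * y)))]
  congr 1
  simp_rw [hv]
  rw [Finset.prod_ite, Finset.prod_const_one, one_mul]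
  congr 1
  ext i
  simp

/-- The measures of the interpolation formula. -/
noncomputable def pathMeasure (p : ι → Prop) [DecidablePred p] (T : Matrix ι κ ℝ) (s : Finset ι) :
    Measure (ι → ℝ) :=
  (((volume.restrict (Set.Ioo (0 : ℝ) 1)).withDensity fun t =>
      ENNReal.ofReal (-deriv (blockMinor p (T * Tᵀ) s) t / 2)).prod
    (((stdGauss (κ ⊕ κ)).prod ((stdGauss (κ ⊕ κ)).prod (stdGauss (κ ⊕ κ)))).prod
      (orthantMeasure s))).map
    fun z i => (blockRoot p T z.1 *ᵥ z.2.1.1) i ^ 2 + ((blockRoot p T z.1 *ᵥ z.2.1.2.1) i ^ 2 +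
      (blockRoot p T z.1 *ᵥ z.2.1.2.2) i ^ 2) + z.2.2 i

omit [Fintype ι] [DecidableEq ι] in
lemma measurable_blockRoot_mulVec (p : ι → Prop) [DecidablePred p] (T : Matrix ι κ ℝ) (i : ι) :
    Measurable fun z : ℝ × (κ ⊕ κ → ℝ) => (blockRoot p T z.1 *ᵥ z.2) i := by
  simp only [Matrix.mulVec, dotProduct, blockRoot, Matrix.of_apply, Fintype.sum_sum_type,
    Sum.elim_inl, Sum.elim_inr]
  split_ifs <;> fun_prop

omit [Fintype ι] [DecidableEq ι] in
lemma measurable_pathMap (p : ι → Prop) [DecidablePred p] (T : Matrix ι κ ℝ) :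
    Measurable fun (z : ℝ × ((κ ⊕ κ → ℝ) × (κ ⊕ κ → ℝ) × (κ ⊕ κ → ℝ)) × (ι → ℝ)) i =>
      (blockRoot p T z.1 *ᵥ z.2.1.1) i ^ 2 + ((blockRoot p T z.1 *ᵥ z.2.1.2.1) i ^ 2 +
        (blockRoot p T z.1 *ᵥ z.2.1.2.2) i ^ 2) + z.2.2 i := by
  have h := measurable_blockRoot_mulVec p T
  refine measurable_pi_lambda _ fun i => ((((h i).comp (by fun_prop :
    Measurable fun z : ℝ × ((κ ⊕ κ → ℝ) × (κ ⊕ κ → ℝ) × (κ ⊕ κ → ℝ)) × (ι → ℝ) =>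
      (z.1, z.2.1.1))).pow_const 2).add ((((h i).comp (by fun_prop :
    Measurable fun z : ℝ × ((κ ⊕ κ → ℝ) × (κ ⊕ κ → ℝ) × (κ ⊕ κ → ℝ)) × (ι → ℝ) =>
      (z.1, z.2.1.2.1))).pow_const 2).add (((h i).comp (by fun_prop :
    Measurable fun z : ℝ × ((κ ⊕ κ → ℝ) × (κ ⊕ κ → ℝ) × (κ ⊕ κ → ℝ)) × (ι → ℝ) =>
      (z.1, z.2.1.2.2))).pow_const 2))).add (by fun_prop)

lemma ae_nonneg_pathMeasure (p : ι → Prop) [DecidablePred p] (T : Matrix ι κ ℝ) (s : Finset ι) :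
    ∀ᵐ x ∂pathMeasure p T s, ∀ i, 0 ≤ x i := by
  rw [pathMeasure, ae_map_iff (measurable_pathMap p T).aemeasurable]
  · have h := (Measure.quasiMeasurePreserving_snd.comp Measure.quasiMeasurePreserving_snd).ae
      (μa := ((volume.restrict (Set.Ioo (0 : ℝ) 1)).withDensity fun t =>
        ENNReal.ofReal (-deriv (blockMinor p (T * Tᵀ) s) t / 2)).prod
        (((stdGauss (κ ⊕ κ)).prod ((stdGauss (κ ⊕ κ)).prod (stdGauss (κ ⊕ κ)))).prod
        (orthantMeasure s))) (ae_nonneg_orthantMeasure s)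
    filter_upwards [h] with z hz i
    have := hz i
    simp only [Function.comp_apply] at this
    positivity
  · simp only [measurableSet_setOfPred]; fun_prop

lemma lintegral_exp_neg_pathMeasure (p : ι → Prop) [DecidablePred p] (T : Matrix ι κ ℝ)
    (s : Finset ι) {l : ι → ℝ} (hl : ∀ i, 0 < l i) :
    ∫⁻ x, ENNReal.ofReal (Real.exp (-∑ i, l i * x i)) ∂pathMeasure p T s =
      (∫⁻ t in Set.Ioo (0 : ℝ) 1, ENNReal.ofReal (-deriv (blockMinor p (T * Tᵀ) s) t / 2) *
          ENNReal.ofReal (√(pathDet p (T * Tᵀ) l t))⁻¹ ^ 3) *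
        ENNReal.ofReal (∏ i ∈ sᶜ, (l i)⁻¹) := by
  classical
  have hE : Measurable fun x : ι → ℝ => ENNReal.ofReal (Real.exp (-∑ i, l i * x i)) := by fun_prop
  have hd : Measurable fun t => ENNReal.ofReal (-deriv (blockMinor p (T * Tᵀ) s) t / 2) :=
    ((measurable_deriv _).neg.div_const 2).ennreal_ofReal
  have hpm := hE.comp (measurable_pathMap p T)
  rw [pathMeasure, lintegral_map hE (measurable_pathMap p T)]
  refine (lintegral_prod _ hpm.aemeasurable).trans ?_
  rw [lintegral_withDensity_eq_lintegral_mul _ hd hpm.lintegral_prod_right',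
    ← lintegral_mul_const' _ _ ENNReal.ofReal_ne_top]
  refine setLIntegral_congr_fun measurableSet_Ioo fun t ht => ?_
  simp only [Pi.mul_apply]
  rw [mul_assoc]
  congr 1
  have hx : Measurable fun x : κ ⊕ κ → ℝ =>
      ENNReal.ofReal (Real.exp (-∑ i, l i * (blockRoot p T t *ᵥ x) i ^ 2)) :=
    hE.comp (measurable_mulVec_sq (blockRoot p T t))
  have hval : ∫⁻ x, ENNReal.ofReal (Real.exp (-∑ i, l i * (blockRoot p T t *ᵥ x) i ^ 2))
      ∂stdGauss (κ ⊕ κ) = ENNReal.ofReal (√(pathDet p (T * Tᵀ) l t))⁻¹ := by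
    rw [lintegral_exp_neg_sum_mul_sq _ fun i => (hl i).le,
      blockRoot_mul_transpose p T ht.1.le ht.2.le, pathDet]
  have hsplit : ∀ a b c u : ι → ℝ,
      ENNReal.ofReal (Real.exp (-∑ i, l i * (a i + (b i + c i) + u i))) =
      ENNReal.ofReal (Real.exp (-∑ i, l i * a i)) * (ENNReal.ofReal (Real.exp (-∑ i, l i * b i)) *
        ENNReal.ofReal (Real.exp (-∑ i, l i * c i))) *
        ENNReal.ofReal (Real.exp (-∑ i, l i * u i)) := by
    intro a b c u
    rw [← ENNReal.ofReal_mul (Real.exp_pos _).le, ← ENNReal.ofReal_mul (Real.exp_pos _).le,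
      ← ENNReal.ofReal_mul (by positivity), ← Real.exp_add, ← Real.exp_add, ← Real.exp_add]
    congr 2
    simp only [mul_add, Finset.sum_add_distrib]
    ring
  refine (lintegral_congr fun z => hsplit _ _ _ _).trans ?_
  have h2 : Measurable fun z : (κ ⊕ κ → ℝ) × (κ ⊕ κ → ℝ) =>
      ENNReal.ofReal (Real.exp (-∑ i, l i * (blockRoot p T t *ᵥ z.1) i ^ 2)) *
        ENNReal.ofReal (Real.exp (-∑ i, l i * (blockRoot p T t *ᵥ z.2) i ^ 2)) :=
    (hx.comp measurable_fst).mul (hx.comp measurable_snd)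
  have h3 : Measurable fun z : (κ ⊕ κ → ℝ) × (κ ⊕ κ → ℝ) × (κ ⊕ κ → ℝ) =>
      ENNReal.ofReal (Real.exp (-∑ i, l i * (blockRoot p T t *ᵥ z.1) i ^ 2)) *
        (ENNReal.ofReal (Real.exp (-∑ i, l i * (blockRoot p T t *ᵥ z.2.1) i ^ 2)) *
        ENNReal.ofReal (Real.exp (-∑ i, l i * (blockRoot p T t *ᵥ z.2.2) i ^ 2))) :=
    (hx.comp measurable_fst).mul (h2.comp measurable_snd)
  rw [lintegral_prod_mul h3.aemeasurable hE.aemeasurable,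
    lintegral_prod_mul hx.aemeasurable h2.aemeasurable,
    lintegral_prod_mul hx.aemeasurable hx.aemeasurable, hval,
    lintegral_exp_neg_orthantMeasure s hl]
  ring

omit [DecidableEq ι] in
lemma lintegral_exp_neg_conv (M N : Measure (ι → ℝ)) [SFinite N] (l : ι → ℝ) :
    ∫⁻ x, ENNReal.ofReal (Real.exp (-∑ i, l i * x i)) ∂(M ∗ N) =
      (∫⁻ x, ENNReal.ofReal (Real.exp (-∑ i, l i * x i)) ∂M) *
        ∫⁻ x, ENNReal.ofReal (Real.exp (-∑ i, l i * x i)) ∂N := by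
  rw [Measure.lintegral_conv (by fun_prop), ← lintegral_mul_const _ (by fun_prop)]
  refine lintegral_congr fun x => ?_
  rw [← lintegral_const_mul _ (by fun_prop)]
  refine lintegral_congr fun y => ?_
  rw [← ENNReal.ofReal_mul (Real.exp_pos _).le, ← Real.exp_add]
  simp [mul_add, Finset.sum_add_distrib, add_comm]

omit [DecidableEq ι] in
lemma ae_nonneg_conv {M N : Measure (ι → ℝ)} [SFinite N] (hM : ∀ᵐ x ∂M, ∀ i, 0 ≤ x i)
    (hN : ∀ᵐ x ∂N, ∀ i, 0 ≤ x i) : ∀ᵐ x ∂(M ∗ N), ∀ i, 0 ≤ x i := by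
  rw [Measure.conv, ae_map_iff (by fun_prop)]
  · filter_upwards [Measure.quasiMeasurePreserving_fst.ae hM,
      Measure.quasiMeasurePreserving_snd.ae hN] with z h1 h2 i
    exact add_nonneg (h1 i) (h2 i)
  · simp only [measurableSet_setOfPred]; fun_prop

lemma sqLaw_conv_orthantMeasure_eq (p : ι → Prop) [DecidablePred p] (T : Matrix ι κ ℝ) :
    sqLaw (blockRoot p T 1) ∗ orthantMeasure ∅ =
      sqLaw (blockRoot p T 0) ∗ orthantMeasure ∅ + Measure.sum (pathMeasure p T) := by
  have hD : ∀ {l : ι → ℝ} {t : ℝ}, (∀ i, 0 < l i) → 0 ≤ t → t ≤ 1 →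
      ∫⁻ x, ENNReal.ofReal (Real.exp (-∑ i, l i * x i)) ∂sqLaw (blockRoot p T t) =
        ENNReal.ofReal (√(pathDet p (T * Tᵀ) l t))⁻¹ := by
    intro l t hl h0 h1
    rw [lintegral_exp_neg_sqLaw _ fun i => (hl i).le, blockRoot_mul_transpose p T h0 h1, pathDet]
  refine ext_of_lintegral_exp_neg
    (ae_nonneg_conv (ae_nonneg_sqLaw _) (ae_nonneg_orthantMeasure _)) ?_ ?_ fun l hl => ?_
  · rw [ae_add_measure_iff]
    exact ⟨ae_nonneg_conv (ae_nonneg_sqLaw _) (ae_nonneg_orthantMeasure _),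
      Measure.ae_sum_iff.mpr fun s => ae_nonneg_pathMeasure p T s⟩
  · have := lintegral_exp_neg_conv (sqLaw (blockRoot p T 1)) (orthantMeasure ∅) fun _ => 1
    rw [hD (fun _ => zero_lt_one) zero_le_one le_rfl,
      lintegral_exp_neg_orthantMeasure ∅ fun _ => zero_lt_one] at this
    simp only [one_mul] at this
    rw [this]
    exact ENNReal.mul_ne_top ENNReal.ofReal_ne_top ENNReal.ofReal_ne_top
  · rw [lintegral_add_measure, lintegral_sum_measure, tsum_fintype, lintegral_exp_neg_conv,
      lintegral_exp_neg_conv, hD hl zero_le_one le_rfl, hD hl le_rfl zero_le_one,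
      lintegral_exp_neg_orthantMeasure ∅ hl, ofReal_inv_sqrt_pathDet p T fun i => (hl i).le,
      add_mul, Finset.sum_mul]
    congr 1
    refine Finset.sum_congr rfl fun s _ => ?_
    rw [lintegral_exp_neg_pathMeasure p T s hl, mul_right_comm, mul_comm,
      ← ENNReal.ofReal_mul (Finset.prod_nonneg fun i _ => (hl i).le)]
    congr 2
    rw [Finset.compl_empty, ← Finset.prod_mul_prod_compl s fun i => (l i)⁻¹, ← mul_assoc,
      ← Finset.prod_mul_distrib, Finset.prod_congr rfl fun i _ => mul_inv_cancel₀ (hl i).ne']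
    simp

end SquareLaw

section Slabs

variable {ι κ : Type*} [Fintype ι] [DecidableEq ι] [Fintype κ]

omit [DecidableEq ι] in
lemma measurableSet_forall_le (a : ι → ℝ) : MeasurableSet {x : ι → ℝ | ∀ i, x i ≤ a i} := by
  simp only [measurableSet_setOfPred]; fun_prop

lemma conv_orthantMeasure_apply (M : Measure (ι → ℝ)) [SFinite M] (a b : ι → ℝ) :
    (M ∗ orthantMeasure ∅) (Set.univ.pi fun i => Set.Ioc (a i) (b i)) =
      ∫⁻ w, ∏ i, volume (Set.Ioc (a i - w i) (b i - w i) ∩ Set.Ici 0) ∂M := by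
  have hB : MeasurableSet (Set.univ.pi fun i => Set.Ioc (a i) (b i)) :=
    MeasurableSet.univ_pi fun i => measurableSet_Ioc
  rw [Measure.conv, Measure.map_apply (by fun_prop) hB,
    Measure.prod_apply (hB.preimage (by fun_prop))]
  refine lintegral_congr fun w => ?_
  have : Prod.mk w ⁻¹' ((fun x : (ι → ℝ) × (ι → ℝ) => x.1 + x.2) ⁻¹'
      Set.univ.pi fun i => Set.Ioc (a i) (b i)) =
      Set.univ.pi fun i => Set.Ioc (a i - w i) (b i - w i) := by
    ext u
    simp [Set.mem_pi, sub_lt_iff_lt_add', le_sub_iff_add_le']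
  rw [this, orthantMeasure, Measure.pi_pi]
  refine Finset.prod_congr rfl fun i _ => ?_
  simp [orthantFactor, Measure.restrict_apply]

lemma sqLaw_le_of_add (p : ι → Prop) [DecidablePred p] (T : Matrix ι κ ℝ) (a : ι → ℝ) {ε : ℝ}
    (hε : 0 < ε) :
    sqLaw (blockRoot p T 0) {x | ∀ i, x i ≤ a i} ≤
      sqLaw (blockRoot p T 1) {x | ∀ i, x i ≤ a i + ε} := by
  let v : ℝ≥0∞ := ENNReal.ofReal ε ^ Fintype.card ι
  have hv0 : v ≠ 0 := pow_ne_zero _ (by simpa using hε)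
  have hv : v ≠ ∞ := ENNReal.pow_ne_top ENNReal.ofReal_ne_top
  refine (ENNReal.mul_le_mul_iff_right hv0 hv).mp ?_
  have hle : sqLaw (blockRoot p T 0) ∗ orthantMeasure ∅ ≤
      sqLaw (blockRoot p T 1) ∗ orthantMeasure ∅ := by
    rw [sqLaw_conv_orthantMeasure_eq]
    exact Measure.le_add_right le_rfl
  refine le_trans ?_ ((hle (Set.univ.pi fun i => Set.Ioc (a i) (a i + ε))).trans ?_)
  · rw [conv_orthantMeasure_apply, ← lintegral_indicator_const (measurableSet_forall_le a)]
    refine lintegral_mono (Set.indicator_le fun x hx => ?_)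
    have : ∀ i, volume (Set.Ioc (a i - x i) (a i + ε - x i) ∩ Set.Ici 0) = ENNReal.ofReal ε := by
      intro i
      rw [Set.inter_eq_left.mpr fun y hy => ?_, Real.volume_Ioc]
      · congr 1; ring
      · exact (sub_nonneg.mpr (hx i)).trans hy.1.le
    simp [this, v, Finset.card_univ]
  · rw [conv_orthantMeasure_apply,
      ← lintegral_indicator_const (measurableSet_forall_le fun i => a i + ε)]
    refine lintegral_mono fun w => ?_
    by_cases hw : ∀ i, w i ≤ a i + ε
    · rw [Set.indicator_of_mem (by exact hw)]
      calc _ ≤ ∏ i : ι, ENNReal.ofReal ε := Finset.prod_le_prod' fun i _ =>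
            (measure_mono Set.inter_subset_left).trans (by
              rw [Real.volume_Ioc]; exact ENNReal.ofReal_le_ofReal (by linarith))
        _ = v := by simp [v, Finset.card_univ]
    · push Not at hw
      obtain ⟨i, hi⟩ := hw
      refine le_of_eq_of_le (Finset.prod_eq_zero (Finset.mem_univ i) ?_) zero_le
      convert measure_empty (μ := (volume : Measure ℝ))
      ext y
      simp only [Set.mem_inter_iff, Set.mem_Ioc, Set.mem_Ici, Set.mem_empty_iff_false, iff_false]
      rintro ⟨⟨_, h⟩, h'⟩
      linarith

lemma sqLaw_zero_le_one (p : ι → Prop) [DecidablePred p] (T : Matrix ι κ ℝ) (a : ι → ℝ) :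
    sqLaw (blockRoot p T 0) {x | ∀ i, x i ≤ a i} ≤
      sqLaw (blockRoot p T 1) {x | ∀ i, x i ≤ a i} := by
  have hset : {x : ι → ℝ | ∀ i, x i ≤ a i} =
      ⋂ n : ℕ, {x | ∀ i, x i ≤ a i + 1 / ((n : ℝ) + 1)} := by
    ext x
    simp only [Set.mem_ofPred_eq, Set.mem_iInter]
    refine ⟨fun h n i => (h i).trans (by have : 0 < 1 / ((n : ℝ) + 1) := by positivity
                                         linarith), fun h i => ?_⟩
    have ht : Filter.Tendsto (fun n : ℕ => a i + 1 / ((n : ℝ) + 1)) Filter.atTop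
        (nhds (a i + 0)) := tendsto_const_nhds.add tendsto_one_div_add_atTop_nhds_zero_nat
    rw [add_zero] at ht
    exact ge_of_tendsto' ht fun n => h n i
  have hanti : Antitone fun n : ℕ => {x : ι → ℝ | ∀ i, x i ≤ a i + 1 / ((n : ℝ) + 1)} := by
    intro m n hmn x hx i
    exact (hx i).trans (by gcongr)
  have ht := tendsto_measure_iInter_atTop (μ := sqLaw (blockRoot p T 1))
    (fun n => (measurableSet_forall_le _).nullMeasurableSet) hanti ⟨0, measure_ne_top _ _⟩
  rw [← hset] at ht
  exact ge_of_tendsto' ht fun n => sqLaw_le_of_add p T a (by positivity)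

omit [DecidableEq ι] in
lemma sqLaw_apply (S : Matrix ι κ ℝ) {c : ι → ℝ} (hc : ∀ i, 0 ≤ c i) :
    sqLaw S {x | ∀ i, x i ≤ c i ^ 2} = stdGauss κ {x | ∀ i, |(S *ᵥ x) i| ≤ c i} := by
  rw [sqLaw, Measure.map_apply (measurable_mulVec_sq S) (measurableSet_forall_le _)]
  congr 1
  ext x
  exact forall_congr' fun i => sq_le_sq.trans (by rw [abs_of_nonneg (hc i)])

omit [Fintype ι] [DecidableEq ι] in
lemma measurableSet_slabs [Finite ι] (q : ι → Prop) (T : Matrix ι κ ℝ) (c : ι → ℝ) :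
    MeasurableSet {x | ∀ i, q i → |(T *ᵥ x) i| ≤ c i} := by
  simp only [Set.ofPred_forall, Matrix.mulVec, dotProduct]
  exact MeasurableSet.iInter fun i => MeasurableSet.iInter fun _ =>
    measurableSet_le (by fun_prop) measurable_const

omit [DecidableEq ι] in
/-- The Gaussian correlation inequality for finite intersections of slabs. -/
lemma stdGauss_slabs_mul_le (p : ι → Prop) [DecidablePred p] (T : Matrix ι κ ℝ) {c : ι → ℝ}
    (hc : ∀ i, 0 ≤ c i) :
    stdGauss κ {x | ∀ i, p i → |(T *ᵥ x) i| ≤ c i} *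
        stdGauss κ {x | ∀ i, ¬ p i → |(T *ᵥ x) i| ≤ c i} ≤
      stdGauss κ {x | ∀ i, |(T *ᵥ x) i| ≤ c i} := by
  classical
  have h1 : sqLaw (blockRoot p T 1) = sqLaw T := sqLaw_congr (by
    rw [blockRoot_mul_transpose p T zero_le_one le_rfl]
    ext i j
    simp [blockScale])
  have h := sqLaw_zero_le_one p T fun i => c i ^ 2
  rw [h1, sqLaw_apply _ hc, sqLaw_apply _ hc] at h
  refine le_of_eq_of_le ?_ h
  have hp := measurePreserving_sumPiEquivProdPi fun _ : κ ⊕ κ => gaussianReal 0 1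
  rw [← Measure.prod_prod, ← hp.measure_preimage
    ((measurableSet_slabs _ T c).prod (measurableSet_slabs _ T c)).nullMeasurableSet]
  congr 1
  ext z
  have hz : ∀ i, (blockRoot p T 0 *ᵥ z) i =
      if p i then (T *ᵥ fun k => z (Sum.inl k)) i else (T *ᵥ fun k => z (Sum.inr k)) i := by
    intro i
    simp only [Matrix.mulVec, dotProduct, blockRoot, Matrix.of_apply, Fintype.sum_sum_type,
      Sum.elim_inl, Sum.elim_inr]
    split_ifs <;> simp
  simp only [Set.mem_preimage, Set.mem_prod, Set.mem_ofPred_eq, hz]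
  constructor
  · rintro ⟨ha, hb⟩ i
    split_ifs with hi
    · exact ha i hi
    · exact hb i hi
  · intro h
    refine ⟨fun i hi => ?_, fun i hi => ?_⟩
    · have := h i; rwa [if_pos hi] at this
    · have := h i; rwa [if_neg hi] at this

end Slabs

section FiniteDimensional

variable {κ : Type*} [Fintype κ]

lemma stdGauss_absolutelyContinuous : stdGauss κ ≪ volume := by
  have h : stdGauss κ =
      (volume : Measure (κ → ℝ)).withDensity fun x =>
        ENNReal.ofReal (∏ i, gaussianPDFReal 0 1 (x i)) := by
    refine Measure.pi_eq fun s hs => ?_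
    rw [withDensity_apply _ (MeasurableSet.univ_pi hs), volume_pi, Measure.restrict_pi_pi,
      ← ofReal_integral_eq_lintegral_ofReal
        (Integrable.fintype_prod fun i => (integrable_gaussianPDFReal 0 1).restrict)
        (ae_of_all _ fun x => Finset.prod_nonneg fun i _ => gaussianPDFReal_nonneg _ _ _),
      integral_fintype_prod_eq_prod (f := fun _ => gaussianPDFReal 0 1),
      ENNReal.ofReal_prod_of_nonneg fun i _ =>
        integral_nonneg fun x => gaussianPDFReal_nonneg _ _ _]
    exact Finset.prod_congr rfl fun i _ => (gaussianReal_apply_eq_integral 0 one_ne_zero _).symm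
  rw [h]
  exact withDensity_absolutelyContinuous _ _

/-- A closed symmetric convex set is a countable intersection of slabs. -/
lemma exists_eq_iInter_slabs {C : Set (κ → ℝ)} (hC : IsClosed C) (hconv : Convex ℝ C)
    (hsymm : ∀ x ∈ C, -x ∈ C) (hne : C.Nonempty) :
    ∃ (T : Matrix ℕ κ ℝ) (c : ℕ → ℝ), (∀ n, 0 ≤ c n) ∧ C = {x | ∀ n, |(T *ᵥ x) n| ≤ c n} := by
  classical
  have h0 : (0 : κ → ℝ) ∈ C := by
    obtain ⟨x, hx⟩ := hne
    have := hconv hx (hsymm x hx) (a := 1 / 2) (b := 1 / 2) (by norm_num) (by norm_num)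
      (by norm_num)
    simpa using this
  let I := {q : (κ → ℝ) × ℝ // ∀ a ∈ C, |q.1 ⬝ᵥ a| ≤ q.2}
  let U : I → Set (κ → ℝ) := fun q => {y | q.1.2 < |q.1.1 ⬝ᵥ y|}
  have hU : ∀ q, IsOpen (U q) := fun q => by
    refine isOpen_lt continuous_const ?_
    simp only [dotProduct]
    fun_prop
  obtain ⟨J, hJ, hJU⟩ := TopologicalSpace.isOpen_iUnion_countable U hU
  let q₀ : I := ⟨(0, 0), fun a _ => by simp⟩
  obtain ⟨f, hf⟩ := (hJ.insert q₀).exists_eq_range ⟨q₀, Set.mem_insert _ _⟩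
  refine ⟨Matrix.of fun n => (f n).1.1, fun n => (f n).1.2, fun n => ?_, ?_⟩
  · exact (abs_nonneg _).trans ((f n).2 0 h0)
  ext x
  refine ⟨fun hx n => (f n).2 x hx, fun h => ?_⟩
  by_contra hx
  obtain ⟨g, u, hgu, hux⟩ := geometric_hahn_banach_closed_point hconv hC hx
  have hdot : ∀ y, (fun k => g fun j => if k = j then 1 else 0) ⬝ᵥ y = g y := by
    intro y
    have := LinearMap.pi_apply_eq_sum_univ (g : (κ → ℝ) →ₗ[ℝ] ℝ) y
    simp only [ContinuousLinearMap.coe_coe, smul_eq_mul] at this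
    rw [this, dotProduct]
    exact Finset.sum_congr rfl fun i _ => mul_comm _ _
  let q : I := ⟨(fun k => g fun j => if k = j then 1 else 0, u), fun a ha => by
    simp only [hdot]
    refine abs_le.mpr ⟨?_, (hgu a ha).le⟩
    have := hgu _ (hsymm a ha)
    rw [map_neg] at this
    linarith⟩
  have hxq : x ∈ ⋃ i, U i := Set.mem_iUnion.mpr ⟨q, by
    simp only [U, Set.mem_ofPred_eq, q, hdot]
    exact hux.trans_le (le_abs_self _)⟩
  rw [← hJU] at hxq
  obtain ⟨j, hj, hxj⟩ := Set.mem_iUnion₂.mp hxq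
  have : j ∈ Set.range f := hf ▸ Set.mem_insert_of_mem _ hj
  obtain ⟨n, rfl⟩ := this
  exact absurd (h n) (not_le.mpr hxj)

/-- The Gaussian correlation inequality for closed sets in finite dimension. -/
lemma stdGauss_mul_le_of_isClosed {A B : Set (κ → ℝ)} (hA : IsClosed A) (hB : IsClosed B)
    (hAc : Convex ℝ A) (hBc : Convex ℝ B) (hAs : ∀ x ∈ A, -x ∈ A) (hBs : ∀ x ∈ B, -x ∈ B) :
    stdGauss κ A * stdGauss κ B ≤ stdGauss κ (A ∩ B) := by
  rcases A.eq_empty_or_nonempty with rfl | hAn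
  · simp
  rcases B.eq_empty_or_nonempty with rfl | hBn
  · simp
  obtain ⟨T, c, hc, hAT⟩ := exists_eq_iInter_slabs hA hAc hAs hAn
  obtain ⟨R, d, hd, hBR⟩ := exists_eq_iInter_slabs hB hBc hBs hBn
  let E : ℕ → Set (κ → ℝ) := fun n =>
    {x | ∀ i < n, |(T *ᵥ x) i| ≤ c i ∧ |(R *ᵥ x) i| ≤ d i}
  have hE : ∀ n, MeasurableSet (E n) := fun n => by
    simp only [E, Set.ofPred_forall, Matrix.mulVec, dotProduct]
    exact MeasurableSet.iInter fun i => MeasurableSet.iInter fun _ =>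
      MeasurableSet.inter (s₁ := {x : κ → ℝ | |∑ k, T i k * x k| ≤ c i})
        (s₂ := {x : κ → ℝ | |∑ k, R i k * x k| ≤ d i})
        (measurableSet_le (by fun_prop) measurable_const)
        (measurableSet_le (by fun_prop) measurable_const)
  have hAB : A ∩ B = ⋂ n, E n := by
    ext x
    rw [hAT, hBR]
    simp only [Set.mem_inter_iff, Set.mem_ofPred_eq, Set.mem_iInter, E]
    exact ⟨fun h n i _ => ⟨h.1 i, h.2 i⟩, fun h => ⟨fun i => (h (i + 1) i i.lt_succ_self).1,
      fun i => (h (i + 1) i i.lt_succ_self).2⟩⟩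
  have hanti : Antitone E := fun m n hmn x hx i hi => hx i (hi.trans_le hmn)
  have ht := tendsto_measure_iInter_atTop (μ := stdGauss κ)
    (fun n => (hE n).nullMeasurableSet) hanti ⟨0, measure_ne_top _ _⟩
  rw [← hAB] at ht
  refine ge_of_tendsto' ht fun n => ?_
  have h := stdGauss_slabs_mul_le (ι := Fin n ⊕ Fin n) (fun i => i.isLeft = true)
    (Matrix.of (Sum.elim (fun i => T i) fun i => R i))
    (c := Sum.elim (fun i => c i) fun i => d i) (by
      rintro (i | i)
      · exact hc i
      · exact hd i)
  refine (mul_le_mul' (measure_mono ?_) (measure_mono ?_)).trans (h.trans (measure_mono ?_))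
  · rw [hAT]
    rintro x hx (i | i) hi
    · exact hx i
    · simp at hi
  · rw [hBR]
    rintro x hx (i | i) hi
    · simp at hi
    · exact hx i
  · intro x hx i hi
    exact ⟨hx (Sum.inl ⟨i, hi⟩), hx (Sum.inr ⟨i, hi⟩)⟩

/-- The Gaussian correlation inequality in finite dimension. -/
lemma stdGauss_mul_le {A B : Set (κ → ℝ)}
    (hAc : Convex ℝ A) (hBc : Convex ℝ B) (hAs : ∀ x ∈ A, -x ∈ A) (hBs : ∀ x ∈ B, -x ∈ B) :
    stdGauss κ A * stdGauss κ B ≤ stdGauss κ (A ∩ B) := by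
  have hcl : ∀ {C : Set (κ → ℝ)}, Convex ℝ C → closure C =ᵐ[stdGauss κ] C := by
    intro C hC
    have h0 : stdGauss κ (frontier C) = 0 :=
      stdGauss_absolutelyContinuous (hC.addHaar_frontier volume)
    refine (ae_le_set.mpr (measure_mono_null ?_ h0)).antisymm subset_closure.eventuallyLE
    exact fun x hx => ⟨hx.1, fun h => hx.2 (interior_subset h)⟩
  have hsy : ∀ {C : Set (κ → ℝ)}, (∀ x ∈ C, -x ∈ C) → ∀ x ∈ closure C, -x ∈ closure C :=
    fun hC x hx => map_mem_closure continuous_neg hx hC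
  calc stdGauss κ A * stdGauss κ B ≤ stdGauss κ (closure A) * stdGauss κ (closure B) :=
        mul_le_mul' (measure_mono subset_closure) (measure_mono subset_closure)
    _ ≤ stdGauss κ (closure A ∩ closure B) := stdGauss_mul_le_of_isClosed isClosed_closure
        isClosed_closure hAc.closure hBc.closure (hsy hAs) (hsy hBs)
    _ = stdGauss κ (A ∩ B) := measure_congr ((hcl hAc).inter (hcl hBc))

end FiniteDimensional

section PrekopaLeindler

open scoped Pointwise

lemma volume_image_mul_add {a : ℝ} (ha : 0 < a) (c : ℝ) (K : Set ℝ) :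
    volume ((fun x => a * x + c) '' K) = ENNReal.ofReal a * volume K := by
  have : (fun x => a * x + c) '' K = (fun x => x + c) '' (a • K) := by
    rw [← Set.image_smul, Set.image_image]; rfl
  rw [this, Set.image_add_right, measure_preimage_add_right, Measure.addHaar_smul]
  simp [abs_of_pos ha]

/-- The Brunn–Minkowski inequality on the line. -/
lemma volume_add_le_of_forall_mem {A B C : Set ℝ} (hA : MeasurableSet A) (hB : MeasurableSet B)
    (hAn : A.Nonempty) (hBn : B.Nonempty) {a b : ℝ} (ha : 0 < a) (hb : 0 < b)
    (h : ∀ x ∈ A, ∀ y ∈ B, a * x + b * y ∈ C) :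
    ENNReal.ofReal a * volume A + ENNReal.ofReal b * volume B ≤ volume C := by
  have hcompact : ∀ K L : Set ℝ, K ⊆ A → L ⊆ B → IsCompact K → IsCompact L → K.Nonempty →
      L.Nonempty → ENNReal.ofReal a * volume K + ENNReal.ofReal b * volume L ≤ volume C := by
    intro K L hKA hLB hK hL hKn hLn
    obtain ⟨k, hkK, hk⟩ := hK.exists_isGreatest hKn
    obtain ⟨m, hmL, hm⟩ := hL.exists_isLeast hLn
    have hL' : MeasurableSet ((fun x => b * x + a * k) '' L) :=
      (hL.image (by fun_prop)).measurableSet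
    have h0 : volume (((fun x => a * x + b * m) '' K) ∩ ((fun x => b * x + a * k) '' L)) = 0 :=
      measure_mono_null (t := {a * k + b * m}) ?_ (by simp)
    rw [← volume_image_mul_add ha (b * m), ← volume_image_mul_add hb (a * k),
      ← measure_union_add_inter _ hL', h0, add_zero]
    · refine measure_mono (Set.union_subset ?_ ?_)
      · rintro _ ⟨x, hx, rfl⟩
        exact h x (hKA hx) m (hLB hmL)
      · rintro _ ⟨y, hy, rfl⟩
        simp only [add_comm (b * y)]
        exact h k (hKA hkK) y (hLB hy)
    · rintro z ⟨⟨x, hx, rfl⟩, ⟨y, hy, hxy⟩⟩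
      have h1 := mul_le_mul_of_nonneg_left (hk hx) ha.le
      have h2 := mul_le_mul_of_nonneg_left (hm hy) hb.le
      simp only [Set.mem_singleton_iff] at *
      linarith
  have hsup : ∀ {D : Set ℝ}, MeasurableSet D → D.Nonempty →
      volume D = ⨆ K : {K : Set ℝ // K ⊆ D ∧ IsCompact K ∧ K.Nonempty}, volume K.1 := by
    intro D hD hDn
    refine le_antisymm (le_of_forall_lt fun r hr => ?_) (iSup_le fun K => measure_mono K.2.1)
    obtain ⟨K, hKD, hK, hrK⟩ := hD.exists_lt_isCompact hr
    refine hrK.trans_le (le_iSup_of_le ⟨K, hKD, hK, ?_⟩ le_rfl)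
    exact nonempty_of_measure_ne_zero (zero_le.trans_lt hrK).ne'
  have hne : ∀ {D : Set ℝ}, D.Nonempty → Nonempty {K : Set ℝ // K ⊆ D ∧ IsCompact K ∧ K.Nonempty} :=
    fun ⟨x, hx⟩ => ⟨{x}, by simpa using hx, isCompact_singleton, Set.singleton_nonempty x⟩
  have := hne hAn
  have := hne hBn
  rw [hsup hA hAn, hsup hB hBn, ENNReal.mul_iSup, ENNReal.mul_iSup]
  exact ENNReal.iSup_add_iSup_le fun K L =>
    hcompact _ _ K.2.1 L.2.1 K.2.2.1 L.2.2.1 K.2.2.2 L.2.2.2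

lemma lintegral_le_of_sup_eq_one {f g h : ℝ → ℝ} (hf : Measurable f) (hg : Measurable g)
    (hh : Measurable h) (hf0 : ∀ x, 0 ≤ f x) (hg0 : ∀ x, 0 ≤ g x) (hh0 : ∀ x, 0 ≤ h x)
    (hf1 : ∀ x, f x ≤ 1) (hg1 : ∀ x, g x ≤ 1) (hfs : ∀ t < 1, ∃ x, t < f x)
    (hgs : ∀ t < 1, ∃ x, t < g x) {a b : ℝ} (ha : 0 < a) (hb : 0 < b) (hab : a + b = 1)
    (H : ∀ x y, f x ^ a * g y ^ b ≤ h (a * x + b * y)) :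
    (ENNReal.ofReal a * ∫⁻ x, ENNReal.ofReal (f x)) +
      (ENNReal.ofReal b * ∫⁻ x, ENNReal.ofReal (g x)) ≤ ∫⁻ x, ENNReal.ofReal (h x) := by
  have hlayer : ∀ {u : ℝ → ℝ}, Measurable u → (∀ x, 0 ≤ u x) → (∀ x, u x ≤ 1) →
      ∫⁻ x, ENNReal.ofReal (u x) = ∫⁻ t in Set.Ioo (0 : ℝ) 1, volume {x | t < u x} := by
    intro u hu hu0 hu1
    rw [lintegral_eq_lintegral_meas_lt _ (ae_of_all _ hu0) hu.aemeasurable]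
    rw [← lintegral_indicator measurableSet_Ioi, ← lintegral_indicator measurableSet_Ioo]
    congr 1 with t
    rcases lt_or_ge t 1 with h1 | h1
    · simp [Set.indicator_apply, h1]
    · have : {x | t < u x} = ∅ := by
        ext x
        simpa using (hu1 x).trans h1
      simp [Set.indicator_apply, this]
  have hm : ∀ u : ℝ → ℝ, Measurable fun t : ℝ => volume {x | t < u x} := fun u =>
    (show Antitone fun t : ℝ => volume {x | t < u x} from
      fun s t hst => measure_mono fun x hx => lt_of_le_of_lt hst hx).measurable
  rw [hlayer hf hf0 hf1, hlayer hg hg0 hg1, lintegral_eq_lintegral_meas_lt _ (ae_of_all _ hh0)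
    hh.aemeasurable, ← lintegral_const_mul _ (hm f), ← lintegral_const_mul _ (hm g),
    ← lintegral_add_left ((hm f).const_mul _)]
  refine le_trans (setLIntegral_mono' measurableSet_Ioo fun t ht => ?_)
    (lintegral_mono_set Set.Ioo_subset_Ioi_self)
  refine volume_add_le_of_forall_mem (measurableSet_lt measurable_const hf)
    (measurableSet_lt measurable_const hg) (hfs t ht.2) (hgs t ht.2) ha hb fun x hx y hy => ?_
  refine lt_of_lt_of_le ?_ (H x y)
  calc t = t ^ a * t ^ b := by rw [← Real.rpow_add ht.1, hab, Real.rpow_one]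
    _ < f x ^ a * g y ^ b := mul_lt_mul'' (Real.rpow_lt_rpow ht.1.le hx ha)
        (Real.rpow_lt_rpow ht.1.le hy hb) (Real.rpow_nonneg ht.1.le _)
        (Real.rpow_nonneg ht.1.le _)

lemma rpow_mul_rpow_le_add (u v : ℝ≥0∞) {a b : ℝ} (ha : 0 < a) (hb : 0 < b) (hab : a + b = 1) :
    u ^ a * v ^ b ≤ ENNReal.ofReal a * u + ENNReal.ofReal b * v := by
  rcases eq_or_ne u ∞ with rfl | hu
  · rw [ENNReal.mul_top (by simpa using ha)]; simp
  rcases eq_or_ne v ∞ with rfl | hv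
  · rw [ENNReal.mul_top (a := ENNReal.ofReal b) (by simpa using hb)]; simp
  lift u to ℝ≥0 using hu
  lift v to ℝ≥0 using hv
  have := NNReal.geom_mean_le_arith_mean2_weighted ⟨a, ha.le⟩ ⟨b, hb.le⟩ u v (by ext; exact hab)
  rw [← ENNReal.coe_rpow_of_nonneg _ ha.le, ← ENNReal.coe_rpow_of_nonneg _ hb.le,
    ENNReal.ofReal_eq_coe_nnreal ha.le, ENNReal.ofReal_eq_coe_nnreal hb.le]
  exact_mod_cast this

/-- The conclusion of the Prékopa–Leindler inequality for bounded functions. -/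
def PrekopaLeindler {E : Type*} [AddCommGroup E] [Module ℝ E] [MeasurableSpace E]
    (ν : Measure E) : Prop :=
  ∀ f g h : E → ℝ≥0∞, Measurable f → Measurable g → Measurable h →
    (∃ C : ℝ≥0∞, C ≠ ∞ ∧ ∀ x, f x ≤ C ∧ g x ≤ C) → ∀ a b : ℝ, 0 < a → 0 < b → a + b = 1 →
    (∀ x y, f x ^ a * g y ^ b ≤ h (a • x + b • y)) →
    (∫⁻ x, f x ∂ν) ^ a * (∫⁻ x, g x ∂ν) ^ b ≤ ∫⁻ x, h x ∂ν

/-- The Prékopa–Leindler inequality on the line. -/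
lemma prekopaLeindler_volume : PrekopaLeindler (volume : Measure ℝ) := by
  rintro f g h hf hg hh ⟨C, hC, hfg⟩ a b ha hb hab H
  let M := ⨆ x, f x
  let N := ⨆ x, g x
  have hM : M ≠ ∞ := ((iSup_le fun x => (hfg x).1).trans_lt hC.lt_top).ne
  have hN : N ≠ ∞ := ((iSup_le fun x => (hfg x).2).trans_lt hC.lt_top).ne
  rcases eq_or_ne M 0 with hM0 | hM0
  · have : ∀ x, f x = 0 := fun x => le_zero_iff.mp (hM0 ▸ le_iSup f x)
    simp [this, ha]
  rcases eq_or_ne N 0 with hN0 | hN0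
  · have : ∀ x, g x = 0 := fun x => le_zero_iff.mp (hN0 ▸ le_iSup g x)
    simp [this, hb]
  let P := M ^ a * N ^ b
  have hP0 : P ≠ 0 := mul_ne_zero (by simp [ENNReal.rpow_eq_zero_iff, hM0, hM])
    (by simp [ENNReal.rpow_eq_zero_iff, hN0, hN])
  have hP : P ≠ ∞ := ENNReal.mul_ne_top (ENNReal.rpow_ne_top_of_nonneg ha.le hM)
    (ENNReal.rpow_ne_top_of_nonneg hb.le hN)
  let F := fun x => f x / M
  let G := fun x => g x / N
  let K := fun x => min 1 (h x / P)
  have hF1 : ∀ x, F x ≤ 1 := fun x => ENNReal.div_le_of_le_mul (by simpa using le_iSup f x)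
  have hG1 : ∀ x, G x ≤ 1 := fun x => ENNReal.div_le_of_le_mul (by simpa using le_iSup g x)
  have hK1 : ∀ x, K x ≤ 1 := fun x => min_le_left _ _
  have hFm : Measurable F := hf.div_const _
  have hGm : Measurable G := hg.div_const _
  have hKm : Measurable K := measurable_const.min (hh.div_const _)
  have hne : ∀ {u : ℝ → ℝ≥0∞}, (∀ x, u x ≤ 1) → ∀ x, u x ≠ ∞ := fun hu x =>
    ((hu x).trans_lt ENNReal.one_lt_top).ne
  have hHK : ∀ x y, F x ^ a * G y ^ b ≤ K (a * x + b * y) := by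
    intro x y
    refine le_min ?_ ?_
    · exact mul_le_one' (ENNReal.rpow_le_one (hF1 x) ha.le) (ENNReal.rpow_le_one (hG1 y) hb.le)
    · rw [ENNReal.le_div_iff_mul_le (Or.inl hP0) (Or.inl hP)]
      refine le_trans (le_of_eq ?_) (H x y)
      simp only [F, G, P]
      rw [mul_mul_mul_comm, ← ENNReal.mul_rpow_of_nonneg _ _ ha.le,
        ← ENNReal.mul_rpow_of_nonneg _ _ hb.le, ENNReal.div_mul_cancel hM0 hM,
        ENNReal.div_mul_cancel hN0 hN]
  have hsup : ∀ {u : ℝ → ℝ≥0∞} {Q : ℝ≥0∞}, (⨆ x, u x) = Q → Q ≠ 0 → Q ≠ ∞ → (∀ x, u x / Q ≤ 1) →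
      ∀ t < (1 : ℝ), ∃ x, t < (u x / Q).toReal := by
    intro u Q hQ hQ0 hQt hu1 t ht
    by_contra! hall
    have hle : ∀ x, u x ≤ ENNReal.ofReal t * Q := fun x => by
      rw [← ENNReal.div_le_iff hQ0 hQt, ← ENNReal.ofReal_toReal (hne hu1 x)]
      exact ENNReal.ofReal_le_ofReal (hall x)
    have h1 : Q ≤ ENNReal.ofReal t * Q := by
      conv_lhs => rw [← hQ]
      exact iSup_le hle
    have h2 : ENNReal.ofReal t * Q < 1 * Q :=
      ENNReal.mul_lt_mul_left hQ0 hQt (by simpa using ht)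
    rw [one_mul] at h2
    exact absurd h1 (not_le.mpr h2)
  have key := lintegral_le_of_sup_eq_one hFm.ennreal_toReal hGm.ennreal_toReal hKm.ennreal_toReal
    (fun _ => ENNReal.toReal_nonneg) (fun _ => ENNReal.toReal_nonneg)
    (fun _ => ENNReal.toReal_nonneg) (fun x => ENNReal.toReal_mono ENNReal.one_ne_top (hF1 x))
    (fun x => ENNReal.toReal_mono ENNReal.one_ne_top (hG1 x)) (hsup rfl hM0 hM hF1)
    (hsup rfl hN0 hN hG1) ha hb hab (fun x y => by
      rw [ENNReal.toReal_rpow, ENNReal.toReal_rpow, ← ENNReal.toReal_mul]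
      exact ENNReal.toReal_mono (hne hK1 _) (hHK x y))
  simp_rw [ENNReal.ofReal_toReal (hne hF1 _), ENNReal.ofReal_toReal (hne hG1 _),
    ENNReal.ofReal_toReal (hne hK1 _)] at key
  have hfF : ∫⁻ x, f x = M * ∫⁻ x, F x := by
    rw [← lintegral_const_mul _ hFm]
    exact lintegral_congr fun x => (ENNReal.mul_div_cancel hM0 hM).symm
  have hgG : ∫⁻ x, g x = N * ∫⁻ x, G x := by
    rw [← lintegral_const_mul _ hGm]
    exact lintegral_congr fun x => (ENNReal.mul_div_cancel hN0 hN).symm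
  rw [hfF, hgG, ENNReal.mul_rpow_of_nonneg _ _ ha.le, ENNReal.mul_rpow_of_nonneg _ _ hb.le,
    mul_mul_mul_comm]
  calc P * ((∫⁻ x, F x) ^ a * (∫⁻ x, G x) ^ b) ≤ P * ∫⁻ x, K x :=
        mul_le_mul_right ((rpow_mul_rpow_le_add _ _ ha hb hab).trans key) P
    _ = ∫⁻ x, P * K x := (lintegral_const_mul _ hKm).symm
    _ ≤ ∫⁻ x, h x := lintegral_mono fun x =>
        (mul_le_mul_right (min_le_right _ _) P).trans (ENNReal.mul_div_cancel hP0 hP).le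

lemma prekopaLeindler_gaussianReal : PrekopaLeindler (gaussianReal 0 1) := by
  rintro f g h hf hg hh ⟨C, hC, hfg⟩ a b ha hb hab H
  have hφ := measurable_gaussianPDF 0 1
  rw [gaussianReal_of_var_ne_zero _ one_ne_zero, lintegral_withDensity_eq_lintegral_mul _ hφ hf,
    lintegral_withDensity_eq_lintegral_mul _ hφ hg, lintegral_withDensity_eq_lintegral_mul _ hφ hh]
  have hb1 : ∀ x, gaussianPDF 0 1 x ≤ ENNReal.ofReal (√(2 * Real.pi))⁻¹ := by
    intro x
    refine ENNReal.ofReal_le_ofReal ?_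
    simp only [gaussianPDFReal, NNReal.coe_one, mul_one]
    refine mul_le_of_le_one_right (by positivity) (Real.exp_le_one_iff.mpr ?_)
    have := sq_nonneg (x - 0)
    linarith [div_nonneg this zero_le_two]
  refine prekopaLeindler_volume _ _ _ (hφ.mul hf) (hφ.mul hg) (hφ.mul hh)
    ⟨ENNReal.ofReal (√(2 * Real.pi))⁻¹ * C, ENNReal.mul_ne_top ENNReal.ofReal_ne_top hC,
      fun x => ⟨mul_le_mul' (hb1 x) (hfg x).1, mul_le_mul' (hb1 x) (hfg x).2⟩⟩ a b ha hb hab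
    fun x y => ?_
  simp only [Pi.mul_apply]
  rw [ENNReal.mul_rpow_of_nonneg _ _ ha.le, ENNReal.mul_rpow_of_nonneg _ _ hb.le,
    mul_mul_mul_comm]
  refine mul_le_mul' ?_ (H x y)
  rw [gaussianPDF, gaussianPDF, gaussianPDF,
    ENNReal.ofReal_rpow_of_nonneg (gaussianPDFReal_nonneg _ _ _) ha.le,
    ENNReal.ofReal_rpow_of_nonneg (gaussianPDFReal_nonneg _ _ _) hb.le,
    ← ENNReal.ofReal_mul (Real.rpow_nonneg (gaussianPDFReal_nonneg _ _ _) _)]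
  refine ENNReal.ofReal_le_ofReal ?_
  simp only [gaussianPDFReal, NNReal.coe_one, mul_one, sub_zero, smul_eq_mul]
  have hc : 0 < (√(2 * Real.pi))⁻¹ := by have := Real.pi_pos; positivity
  rw [Real.mul_rpow hc.le (Real.exp_pos _).le, Real.mul_rpow hc.le (Real.exp_pos _).le,
    mul_mul_mul_comm, ← Real.rpow_add hc, hab, Real.rpow_one, ← Real.exp_mul, ← Real.exp_mul,
    ← Real.exp_add]
  refine mul_le_mul_of_nonneg_left (Real.exp_le_exp.mpr ?_) hc.le
  obtain rfl : b = 1 - a := by linarith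
  nlinarith [mul_nonneg (mul_pos ha hb).le (sq_nonneg (x - y))]

variable {E F : Type*} [AddCommGroup E] [Module ℝ E] [MeasurableSpace E]
  [AddCommGroup F] [Module ℝ F] [MeasurableSpace F]

lemma PrekopaLeindler.prod {ν : Measure E} {ρ : Measure F} [IsFiniteMeasure ρ] [SFinite ν]
    (hν : PrekopaLeindler ν) (hρ : PrekopaLeindler ρ) : PrekopaLeindler (ν.prod ρ) := by
  rintro f g h hf hg hh ⟨C, hC, hfg⟩ a b ha hb hab H
  rw [lintegral_prod _ hf.aemeasurable, lintegral_prod _ hg.aemeasurable,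
    lintegral_prod _ hh.aemeasurable]
  have hbd : ∀ {u : E × F → ℝ≥0∞}, (∀ z, u z ≤ C) → ∀ x, ∫⁻ y, u (x, y) ∂ρ ≤ C * ρ Set.univ :=
    fun hu x => (lintegral_mono fun y => hu (x, y)).trans (lintegral_const C).le
  refine hν _ _ _ hf.lintegral_prod_right' hg.lintegral_prod_right' hh.lintegral_prod_right'
    ⟨C * ρ Set.univ, ENNReal.mul_ne_top hC (measure_ne_top _ _), fun x =>
      ⟨hbd (fun z => (hfg z).1) x, hbd (fun z => (hfg z).2) x⟩⟩ a b ha hb hab fun x x' => ?_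
  exact hρ _ _ _ (hf.comp measurable_prodMk_left) (hg.comp measurable_prodMk_left)
    (hh.comp measurable_prodMk_left) ⟨C, hC, fun y => ⟨(hfg _).1, (hfg _).2⟩⟩ a b ha hb hab
    fun y y' => H (x, y) (x', y')

lemma PrekopaLeindler.map {ν : Measure E} (hν : PrekopaLeindler ν) {e : E → F} (he : Measurable e)
    (hlin : ∀ (a b : ℝ) x y, e (a • x + b • y) = a • e x + b • e y) :
    PrekopaLeindler (ν.map e) := by
  rintro f g h hf hg hh ⟨C, hC, hfg⟩ a b ha hb hab H
  rw [lintegral_map hf he, lintegral_map hg he, lintegral_map hh he]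
  exact hν _ _ _ (hf.comp he) (hg.comp he) (hh.comp he) ⟨C, hC, fun x => hfg _⟩ a b ha hb hab
    fun x y => by
      rw [Function.comp_apply, Function.comp_apply, Function.comp_apply, hlin]
      exact H _ _

lemma prekopaLeindler_stdGauss (n : ℕ) : PrekopaLeindler (stdGauss (Fin n)) := by
  induction n with
  | zero =>
    rintro f g h hf hg hh - a b ha hb hab H
    rw [stdGauss, Measure.pi_of_empty, lintegral_dirac' _ hf, lintegral_dirac' _ hg,
      lintegral_dirac' _ hh]
    exact (H _ _).trans (le_of_eq (congrArg h (Subsingleton.elim _ _)))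
  | succ n ih =>
    have h := (measurePreserving_piFinSuccAbove (fun _ : Fin (n + 1) => gaussianReal 0 1) 0).symm
    rw [stdGauss, ← h.map_eq]
    refine (prekopaLeindler_gaussianReal.prod ih).map h.measurable fun a b x y => ?_
    ext i
    refine Fin.cases ?_ (fun j => ?_) i <;> simp [MeasurableEquiv.piFinSuccAbove]

end PrekopaLeindler

section Sequences

open scoped Pointwise symmDiff

/-- The standard Gaussian measure on sequences. -/
noncomputable abbrev seqGauss : Measure (ℕ → ℝ) := Measure.infinitePi fun _ => gaussianReal 0 1

/-- Restriction of a sequence to its first `n` coordinates. -/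
def initial (n : ℕ) (x : ℕ → ℝ) : Fin n → ℝ := fun i => x i

/-- The sequence with first `n` coordinates `u` and the other coordinates those of `y`. -/
def splice {n : ℕ} (u : Fin n → ℝ) (y : ℕ → ℝ) : ℕ → ℝ :=
  fun i => if h : i < n then u ⟨i, h⟩ else y i

lemma continuous_initial (n : ℕ) : Continuous (initial n) := by
  unfold initial; fun_prop

lemma measurable_splice (n : ℕ) :
    Measurable fun p : (Fin n → ℝ) × (ℕ → ℝ) => splice p.1 p.2 := by
  refine measurable_pi_lambda _ fun i => ?_
  by_cases h : i < n <;> simp only [splice, h, dite_true, dite_false] <;> fun_prop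

lemma initial_splice {n : ℕ} (u : Fin n → ℝ) (y : ℕ → ℝ) : initial n (splice u y) = u := by
  ext i; simp [initial, splice]

lemma splice_neg {n : ℕ} (u : Fin n → ℝ) (y : ℕ → ℝ) : splice (-u) (-y) = -splice u y := by
  ext i; by_cases h : i < n <;> simp [splice, h]

lemma splice_combo {n : ℕ} (a b : ℝ) (u v : Fin n → ℝ) (y z : ℕ → ℝ) :
    splice (a • u + b • v) (a • y + b • z) = a • splice u y + b • splice v z := by
  ext i; by_cases h : i < n <;> simp [splice, h]

lemma map_initial_seqGauss (n : ℕ) : seqGauss.map (initial n) = stdGauss (Fin n) := by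
  refine (Measure.pi_eq fun s hs => ?_).symm
  rw [Measure.map_apply (continuous_initial n).measurable (.univ_pi hs)]
  have : initial n ⁻¹' Set.univ.pi s =
      (Finset.range n : Set ℕ).pi fun i => if h : i < n then s ⟨i, h⟩ else Set.univ := by
    ext x
    simp only [initial, Set.mem_preimage, Set.mem_pi, Finset.coe_range,
      Set.mem_Iio]
    exact ⟨fun h i hi => by simpa [hi] using h ⟨i, hi⟩, fun h i => by simpa using h i i.2⟩
  rw [this, Measure.infinitePi_pi, ← Fin.prod_univ_eq_prod_range
    (fun i => gaussianReal 0 1 (if h : i < n then s ⟨i, h⟩ else Set.univ))]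
  · simp
  · intro i hi
    simp only [Finset.mem_range] at hi
    simpa [hi] using hs _

lemma map_splice_seqGauss (n : ℕ) :
    ((stdGauss (Fin n)).prod seqGauss).map (fun p => splice p.1 p.2) = seqGauss := by
  refine Measure.eq_infinitePi _ fun s t ht => ?_
  rw [Measure.map_apply (measurable_splice n) (.pi s.countable_toSet fun _ _ => ht _)]
  have : (fun p : (Fin n → ℝ) × (ℕ → ℝ) => splice p.1 p.2) ⁻¹' (s : Set ℕ).pi t =
      (Set.univ.pi fun i : Fin n => if (i : ℕ) ∈ s then t i else Set.univ) ×ˢ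
        ((s.filter fun i => ¬ i < n : Finset ℕ) : Set ℕ).pi t := by
    ext ⟨u, y⟩
    simp only [Set.mem_preimage, Set.mem_pi, Set.mem_prod, Set.mem_univ, true_imp_iff,
      Finset.mem_coe, Finset.mem_filter]
    refine ⟨fun h => ⟨fun i => ?_, fun i hi => ?_⟩, fun h i hi => ?_⟩
    · split_ifs with hi
      · simpa [splice] using h i hi
      · trivial
    · simpa [splice, hi.2] using h i hi.1
    · by_cases hn : i < n
      · simpa [splice, hn, hi] using h.1 ⟨i, hn⟩
      · simpa [splice, hn] using h.2 i ⟨hi, hn⟩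
  rw [this, Measure.prod_prod, Measure.pi_pi, Measure.infinitePi_pi _ (fun i _ => ht i),
    Fin.prod_univ_eq_prod_range (fun i => gaussianReal 0 1 (if i ∈ s then t i else Set.univ)),
    ← Finset.prod_filter_mul_prod_filter_not s (· < n)]
  congr 1
  have : s.filter (· < n) = Finset.range n ∩ s := by
    ext i; simp [and_comm]
  rw [this, ← Finset.prod_ite_mem]
  refine Finset.prod_congr rfl fun i _ => ?_
  split_ifs <;> simp

lemma _root_.IsCompact.iInter_preimage_initial {K : Set (ℕ → ℝ)} (hK : IsCompact K) :
    ⋂ n, initial n ⁻¹' (initial n '' K) = K := by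
  refine Set.Subset.antisymm (fun x hx => ?_)
    (Set.subset_iInter fun n => Set.subset_preimage_image _ _)
  choose k hkK hk using fun n => Set.mem_iInter.mp hx n
  refine hK.isClosed.mem_of_tendsto (f := k) (b := Filter.atTop) ?_
      (Filter.Eventually.of_forall hkK)
  refine tendsto_pi_nhds.mpr fun i => tendsto_const_nhds.congr' ?_
  filter_upwards [Filter.eventually_gt_atTop i] with n hn
  exact (congrFun (hk n) ⟨i, hn⟩).symm

/-- Two sets of measure at least `r` have combinations of measure at least `r`. -/
lemma le_seqGauss_of_forall_mem {A B C : Set (ℕ → ℝ)} (hA : MeasurableSet A)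
    (hB : MeasurableSet B) {r : ℝ≥0∞} (hrA : r ≤ seqGauss A) (hrB : r ≤ seqGauss B)
    {a b : ℝ} (ha : 0 < a) (hb : 0 < b) (hab : a + b = 1)
    (h : ∀ x ∈ A, ∀ y ∈ B, a • x + b • y ∈ C) : r ≤ seqGauss C := by
  refine le_of_forall_lt fun q hq => ?_
  obtain ⟨q', hqq', hq'⟩ := exists_between hq
  obtain ⟨K, hKA, hK, hqK⟩ := hA.exists_lt_isCompact (hq'.trans_le hrA)
  obtain ⟨L, hLB, hL, hqL⟩ := hB.exists_lt_isCompact (hq'.trans_le hrB)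
  refine hqq'.trans_le ?_
  let M := a • K + b • L
  have hM : IsCompact M := (hK.smul a).add (hL.smul b)
  have hMC : M ⊆ C := by
    rintro _ ⟨_, ⟨x, hx, rfl⟩, _, ⟨y, hy, rfl⟩, rfl⟩
    exact h x (hKA hx) y (hLB hy)
  refine le_trans ?_ (measure_mono hMC)
  have hcl : ∀ {S : Set (ℕ → ℝ)} (n : ℕ), IsCompact S → MeasurableSet (initial n '' S) :=
    fun n hS => (hS.image (continuous_initial n)).measurableSet
  have hanti : Antitone fun n => initial n ⁻¹' (initial n '' M) := by
    rintro m n hmn x ⟨k, hk, hkx⟩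
    exact ⟨k, hk, funext fun i => congrFun hkx ⟨i, i.2.trans_le hmn⟩⟩
  have ht := tendsto_measure_iInter_atTop (μ := seqGauss) (fun n =>
    ((continuous_initial n).measurable (hcl n hM)).nullMeasurableSet) hanti
    ⟨0, measure_ne_top _ _⟩
  rw [hM.iInter_preimage_initial] at ht
  refine ge_of_tendsto' ht fun n => ?_
  have hle : ∀ {S : Set (ℕ → ℝ)}, IsCompact S → q' < seqGauss S →
      q' ≤ stdGauss (Fin n) (initial n '' S) := fun hS hq => by
    rw [← map_initial_seqGauss, Measure.map_apply (continuous_initial n).measurable (hcl n hS)]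
    exact hq.le.trans (measure_mono (Set.subset_preimage_image _ _))
  have key := prekopaLeindler_stdGauss n ((initial n '' K).indicator 1)
    ((initial n '' L).indicator 1) ((initial n '' M).indicator 1)
    (measurable_one.indicator (hcl n hK)) (measurable_one.indicator (hcl n hL))
    (measurable_one.indicator (hcl n hM))
    ⟨1, ENNReal.one_ne_top, fun x => ⟨Set.indicator_le_self _ _ _, Set.indicator_le_self _ _ _⟩⟩
    a b ha hb hab (by
      intro x y
      by_cases hx : x ∈ initial n '' K
      · by_cases hy : y ∈ initial n '' L
        · obtain ⟨k, hk, rfl⟩ := hx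
          obtain ⟨l, hl, rfl⟩ := hy
          have : a • initial n k + b • initial n l ∈ initial n '' M :=
            ⟨a • k + b • l, Set.add_mem_add (Set.smul_mem_smul_set hk) (Set.smul_mem_smul_set hl),
              rfl⟩
          rw [Set.indicator_of_mem this, Set.indicator_of_mem (Set.mem_image_of_mem _ hk),
            Set.indicator_of_mem (Set.mem_image_of_mem _ hl)]
          simp
        · simp [Set.indicator_of_notMem hy, hb]
      · simp [Set.indicator_of_notMem hx, ha])
  rw [lintegral_indicator_one (hcl n hK), lintegral_indicator_one (hcl n hL),
    lintegral_indicator_one (hcl n hM), ← map_initial_seqGauss,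
    Measure.map_apply (continuous_initial n).measurable (hcl n hM), map_initial_seqGauss] at key
  refine le_trans ?_ key
  calc q' = q' ^ a * q' ^ b := by
        rw [← ENNReal.rpow_add_of_nonneg _ _ ha.le hb.le, hab, ENNReal.rpow_one]
    _ ≤ _ := mul_le_mul' (ENNReal.rpow_le_rpow (hle hK hqK) ha.le)
        (ENNReal.rpow_le_rpow (hle hL hqL) hb.le)

end Sequences

section SequenceCorrelation

open scoped Pointwise symmDiff

variable {A B : Set (ℕ → ℝ)} {n : ℕ}

/-- The conditional probability of `A` given that the first `n` coordinates are `u`. -/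
noncomputable def sliceMeasure (A : Set (ℕ → ℝ)) (n : ℕ) (u : Fin n → ℝ) : ℝ≥0∞ :=
  seqGauss {y | splice u y ∈ A}

lemma measurableSet_slice (hA : MeasurableSet A) (u : Fin n → ℝ) :
    MeasurableSet {y | splice u y ∈ A} :=
  ((measurable_splice n).comp measurable_prodMk_left) hA

lemma measurable_sliceMeasure (hA : MeasurableSet A) : Measurable (sliceMeasure A n) :=
  measurable_measure_prodMk_left (measurable_splice n hA)

lemma seqGauss_eq_lintegral_sliceMeasure (hA : MeasurableSet A) (n : ℕ) :
    seqGauss A = ∫⁻ u, sliceMeasure A n u ∂stdGauss (Fin n) := by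
  conv_lhs => rw [← map_splice_seqGauss n]
  rw [Measure.map_apply (measurable_splice n) hA, Measure.prod_apply (measurable_splice n hA)]
  rfl

lemma convex_le_sliceMeasure (hA : MeasurableSet A) (hAc : Convex ℝ A) (r : ℝ≥0∞) :
    Convex ℝ {u : Fin n → ℝ | r ≤ sliceMeasure A n u} := by
  refine convex_iff_forall_pos.mpr fun u hu v hv a b ha hb hab => ?_
  refine le_seqGauss_of_forall_mem (measurableSet_slice hA u) (measurableSet_slice hA v) hu hv
    ha hb hab fun y hy z hz => ?_
  rw [Set.mem_ofPred_eq, splice_combo]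
  exact hAc hy hz ha.le hb.le hab

lemma map_neg_seqGauss : seqGauss.map (fun x => -x) = seqGauss := by
  have h := Measure.infinitePi_map_pi (fun _ : ℕ => gaussianReal 0 1) (f := fun _ x => -x)
    (fun _ => measurable_neg)
  have hg : (gaussianReal 0 1).map (fun x => -x) = gaussianReal 0 1 := by
    simpa using gaussianReal_map_neg (μ := 0) (v := 1)
  simp only [hg] at h
  exact h

lemma sliceMeasure_neg (hA : MeasurableSet A) (hAs : ∀ x ∈ A, -x ∈ A) (u : Fin n → ℝ) :
    sliceMeasure A n (-u) = sliceMeasure A n u := by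
  have h := Measure.map_apply (μ := seqGauss) measurable_neg (measurableSet_slice hA (-u))
  rw [show seqGauss.map Neg.neg = seqGauss from map_neg_seqGauss] at h
  rw [sliceMeasure, h, sliceMeasure]
  congr 1 with y
  simp only [Set.mem_preimage, Set.mem_ofPred_eq, splice_neg]
  exact ⟨fun h => by simpa using hAs _ h, hAs _⟩

lemma exists_preimage_initial_symmDiff_lt (hA : MeasurableSet A) {ε : ℝ≥0∞} (hε : 0 < ε) :
    ∃ N, ∀ n ≥ N, ∃ S : Set (Fin n → ℝ), MeasurableSet S ∧
      seqGauss ((initial n ⁻¹' S) ∆ A) < ε := by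
  obtain ⟨t, ht, htε⟩ := exists_measure_symmDiff_lt_of_generateFrom_isSetRing (μ := seqGauss)
    isSetRing_measurableCylinders ⟨{Set.univ}, Set.countable_singleton _,
      Set.singleton_subset_iff.mpr ((mem_measurableCylinders _).mpr
        ⟨∅, Set.univ, .univ, (cylinder_univ ∅).symm⟩), by simp⟩
    generateFrom_measurableCylinders.symm hA hε
  obtain ⟨s, S, hS, rfl⟩ := (mem_measurableCylinders t).mp ht
  refine ⟨s.sup id + 1, fun n hn => ?_⟩
  have hs : ∀ i ∈ s, i < n := fun i hi =>
    (Nat.lt_succ_of_le (Finset.le_sup (f := id) hi)).trans_le hn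
  exact ⟨(fun u (i : s) => u ⟨i, hs i i.2⟩) ⁻¹' S, hS.preimage (by fun_prop), htε⟩

lemma stdGauss_symmDiff_le (hA : MeasurableSet A) {S : Set (Fin n → ℝ)} (hS : MeasurableSet S) :
    stdGauss (Fin n) ({u | 2⁻¹ ≤ sliceMeasure A n u} ∆ S) ≤
      2 * seqGauss ((initial n ⁻¹' S) ∆ A) := by
  have hm : MeasurableSet ((initial n ⁻¹' S) ∆ A) :=
    ((continuous_initial n).measurable hS).symmDiff hA
  have hB : MeasurableSet {u | 2⁻¹ ≤ sliceMeasure A n u} :=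
    measurableSet_le measurable_const (measurable_sliceMeasure hA)
  rw [seqGauss_eq_lintegral_sliceMeasure hm n, ← lintegral_const_mul _ (measurable_sliceMeasure hm),
    ← lintegral_indicator_one (hB.symmDiff hS)]
  refine lintegral_mono (Set.indicator_le' (fun u hu => ?_) fun u _ => zero_le)
  have h2 : (1 : ℝ≥0∞) = 2 * 2⁻¹ := (ENNReal.mul_inv_cancel two_ne_zero ENNReal.ofNat_ne_top).symm
  rw [Pi.one_apply, h2]
  refine mul_le_mul_right ?_ _
  rcases hu with ⟨hu, huS⟩ | ⟨huS, hu⟩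
  · refine le_trans (b := sliceMeasure A n u) hu (measure_mono fun y hy => Or.inr ⟨hy, ?_⟩)
    simpa [initial_splice] using huS
  · have hc : {y | splice u y ∈ (initial n ⁻¹' S) ∆ A} = {y | splice u y ∈ A}ᶜ := by
      ext y
      simp [Set.mem_symmDiff, initial_splice, huS]
    have hu' : sliceMeasure A n u ≤ 2⁻¹ := (not_le.mp hu).le
    rw [sliceMeasure, hc, prob_compl_eq_one_sub (measurableSet_slice hA u)]
    calc (2⁻¹ : ℝ≥0∞) = 1 - 2⁻¹ := ENNReal.one_sub_inv_two.symm
      _ ≤ 1 - sliceMeasure A n u := tsub_le_tsub_left hu' 1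

/-- Symmetric convex sets of sequences are approximated by symmetric convex cylinders. -/
lemma exists_convex_preimage_initial (hA : MeasurableSet A) (hAc : Convex ℝ A)
    (hAs : ∀ x ∈ A, -x ∈ A) {ε : ℝ} (hε : 0 < ε) :
    ∃ N, ∀ n ≥ N, ∃ B : Set (Fin n → ℝ), MeasurableSet B ∧ Convex ℝ B ∧ (∀ x ∈ B, -x ∈ B) ∧
      seqGauss.real ((initial n ⁻¹' B) ∆ A) ≤ ε := by
  obtain ⟨N, hN⟩ := exists_preimage_initial_symmDiff_lt hA
    (ENNReal.ofReal_pos.mpr (show 0 < ε / 3 by positivity))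
  refine ⟨N, fun n hn => ?_⟩
  obtain ⟨S, hS, hSε⟩ := hN n hn
  have hB : MeasurableSet {u | 2⁻¹ ≤ sliceMeasure A n u} :=
    measurableSet_le measurable_const (measurable_sliceMeasure hA)
  refine ⟨{u | 2⁻¹ ≤ sliceMeasure A n u}, hB, convex_le_sliceMeasure hA hAc _, fun u hu => ?_, ?_⟩
  · rwa [Set.mem_ofPred_eq, sliceMeasure_neg hA hAs]
  have h1 := ENNReal.toReal_mono (by simp [ENNReal.mul_eq_top]) (stdGauss_symmDiff_le hA hS)
  rw [← map_initial_seqGauss, Measure.map_apply (continuous_initial n).measurable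
    (hB.symmDiff hS), Set.preimage_symmDiff, ENNReal.toReal_mul, ENNReal.toReal_ofNat] at h1
  have h2 := ENNReal.toReal_lt_of_lt_ofReal hSε
  have h3 := measureReal_symmDiff_le (μ := seqGauss)
      (s := initial n ⁻¹' {u | 2⁻¹ ≤ sliceMeasure A n u})
    (t := initial n ⁻¹' S) A
  simp only [Measure.real] at *
  linarith

/-- The Gaussian correlation inequality for sequences. -/
lemma seqGauss_mul_le (hA : MeasurableSet A) (hB : MeasurableSet B) (hAc : Convex ℝ A)
    (hBc : Convex ℝ B) (hAs : ∀ x ∈ A, -x ∈ A) (hBs : ∀ x ∈ B, -x ∈ B) :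
    seqGauss A * seqGauss B ≤ seqGauss (A ∩ B) := by
  suffices h : seqGauss.real A * seqGauss.real B ≤ seqGauss.real (A ∩ B) by
    rwa [Measure.real, Measure.real, Measure.real, ← ENNReal.toReal_mul,
      ENNReal.toReal_le_toReal (by finiteness) (by finiteness)] at h
  refine le_of_forall_pos_le_add fun ε hε => ?_
  obtain ⟨N, hN⟩ := exists_convex_preimage_initial hA hAc hAs (show 0 < ε / 4 by positivity)
  obtain ⟨M, hM⟩ := exists_convex_preimage_initial hB hBc hBs (show 0 < ε / 4 by positivity)
  obtain ⟨n, hnN, hnM⟩ := exists_ge_ge N M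
  obtain ⟨C, hC, hCc, hCs, hCA⟩ := hN n hnN
  obtain ⟨D, hD, hDc, hDs, hDB⟩ := hM n hnM
  have hi := (continuous_initial n).measurable
  have key : seqGauss.real (initial n ⁻¹' C) * seqGauss.real (initial n ⁻¹' D) ≤
      seqGauss.real (initial n ⁻¹' C ∩ initial n ⁻¹' D) := by
    have h := stdGauss_mul_le hCc hDc hCs hDs
    rw [← map_initial_seqGauss, Measure.map_apply hi hC, Measure.map_apply hi hD,
      Measure.map_apply hi (hC.inter hD), Set.preimage_inter] at h
    simpa only [Measure.real, ENNReal.toReal_mul] using ENNReal.toReal_mono (measure_ne_top _ _) h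
  have h1 := abs_le.mp ((abs_measureReal_sub_le_measureReal_symmDiff (hi hC).nullMeasurableSet
    hA.nullMeasurableSet).trans hCA)
  have h2 := abs_le.mp ((abs_measureReal_sub_le_measureReal_symmDiff (hi hD).nullMeasurableSet
    hB.nullMeasurableSet).trans hDB)
  have h3 : seqGauss.real (initial n ⁻¹' C ∩ initial n ⁻¹' D) ≤
      seqGauss.real (A ∩ B) + (ε / 4 + ε / 4) := by
    have hsub : initial n ⁻¹' C ∩ initial n ⁻¹' D ⊆
        (A ∩ B) ∪ ((initial n ⁻¹' C) ∆ A ∪ (initial n ⁻¹' D) ∆ B) := by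
      intro x hx
      by_cases hxA : x ∈ A
      · by_cases hxB : x ∈ B
        · exact Or.inl ⟨hxA, hxB⟩
        · exact Or.inr (Or.inr (Or.inl ⟨hx.2, hxB⟩))
      · exact Or.inr (Or.inl (Or.inl ⟨hx.1, hxA⟩))
    refine (measureReal_mono hsub).trans ((measureReal_union_le _ _).trans ?_)
    gcongr
    exact (measureReal_union_le _ _).trans (add_le_add hCA hDB)
  have hA1 : seqGauss.real A ≤ 1 := measureReal_le_one
  have hA0 : 0 ≤ seqGauss.real A := measureReal_nonneg
  have hD0 : 0 ≤ seqGauss.real (initial n ⁻¹' D) := measureReal_nonneg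
  have hD1 : seqGauss.real (initial n ⁻¹' D) ≤ 1 := measureReal_le_one
  nlinarith [mul_nonneg hA0 (sub_nonneg.mpr h2.1), mul_nonneg hD0 (sub_nonneg.mpr h1.1)]

end SequenceCorrelation

section Banach

open scoped Pointwise symmDiff

/-- The Gram–Schmidt process, lifted along a linear map. -/
lemma exists_orthogonal_lift {V E : Type*} [AddCommGroup V] [Module ℝ V] [NormedAddCommGroup E]
    [InnerProductSpace ℝ E] (T : V →ₗ[ℝ] E) (L : ℕ → V) :
    ∃ M : ℕ → V, (∀ n, L n - M n ∈ Submodule.span ℝ (L '' Set.Iio n)) ∧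
      ∀ i j, i ≠ j → inner ℝ (T (M i)) (T (M j)) = 0 := by
  have h : ∀ n, ∃ w ∈ Submodule.span ℝ (L '' Set.Iio n),
      T w = T (L n) - InnerProductSpace.gramSchmidt ℝ (T ∘ L) n := by
    intro n
    rw [← Submodule.mem_map, Submodule.map_span, ← Set.image_comp,
      ← InnerProductSpace.span_gramSchmidt_Iio]
    have hd := InnerProductSpace.gramSchmidt_def'' ℝ (T ∘ L) n
    rw [← Function.comp_apply (f := T), hd, add_sub_cancel_left]
    exact Submodule.sum_mem _ fun i hi => Submodule.smul_mem _ _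
      (Submodule.subset_span ⟨i, Finset.mem_Iio.mp hi, rfl⟩)
  choose w hw hTw using h
  refine ⟨fun n => L n - w n, fun n => by simpa using hw n, fun i j hij => ?_⟩
  simp only [map_sub, hTw, sub_sub_cancel]
  exact InnerProductSpace.gramSchmidt_orthogonal ℝ _ hij

variable {X : Type*} [NormedAddCommGroup X] [NormedSpace ℝ X]

lemma exists_separating_sequence [TopologicalSpace.SeparableSpace X] :
    ∃ L : ℕ → StrongDual ℝ X, ∀ x, (∀ n, L n x = 0) → x = 0 := by
  choose g hg1 hg using fun x : X => exists_dual_vector'' ℝ x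
  refine ⟨fun n => g (TopologicalSpace.denseSeq X n), fun x hx => ?_⟩
  by_contra hne
  obtain ⟨n, hn⟩ := (TopologicalSpace.denseRange_denseSeq X).exists_dist_lt x
    (show 0 < ‖x‖ / 2 by have := norm_pos_iff.mpr hne; positivity)
  set y := TopologicalSpace.denseSeq X n
  have h1 : ‖y‖ ≤ ‖y - x‖ := by
    have h := (g y).le_opNorm (y - x)
    rw [map_sub, hx n, sub_zero, hg y] at h
    simp only [RCLike.ofReal_real_eq_id, id_eq, norm_norm] at h
    exact h.trans (mul_le_of_le_one_left (norm_nonneg _) (hg1 y))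
  rw [dist_eq_norm, norm_sub_rev] at hn
  linarith [norm_sub_norm_le x y, norm_sub_rev x y]

variable [CompleteSpace X] [TopologicalSpace.SeparableSpace X] [MeasurableSpace X] [BorelSpace X]
  {μ : Measure X}

/-- A centered Gaussian measure has an injective linear image that is a product measure. -/
lemma exists_map_eq_infinitePi (hμ : IsCenteredGaussian μ) :
    ∃ M : ℕ → StrongDual ℝ X, (∀ x, (∀ n, M n x = 0) → x = 0) ∧ ∃ v : ℕ → ℝ≥0,
      μ.map (fun x n => M n x) = Measure.infinitePi fun n => gaussianReal 0 (v n) := by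
  have := hμ.1
  have : SecondCountableTopology X := UniformSpace.secondCountable_of_separable X
  have hG : IsGaussian μ := isGaussian_of_map_eq_gaussianReal fun L => ⟨0, hμ.2 L⟩
  choose v hv using hμ.2
  have hmean : ∀ L : StrongDual ℝ X, ∫ x, L x ∂μ = 0 := fun L => by
    rw [← integral_map (f := fun y => y) L.measurable.aemeasurable (by fun_prop), hv L]
    exact integral_id_gaussianReal
  obtain ⟨L, hL⟩ := exists_separating_sequence (X := X)
  obtain ⟨M, hML, hM⟩ := exists_orthogonal_lift (StrongDual.toLp μ 2).toLinearMap L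
  refine ⟨M, fun x hx => hL x fun n => ?_, fun n => v (M n), ?_⟩
  · induction n using Nat.strong_induction_on with
    | _ n ih =>
      have hle : Submodule.span ℝ (L '' Set.Iio n) ≤
          LinearMap.ker (ContinuousLinearMap.apply ℝ ℝ x).toLinearMap := by
        rw [Submodule.span_le]
        rintro _ ⟨i, hi, rfl⟩
        exact ih i hi
      have := hle (hML n)
      simpa [hx n] using this
  · have hind : iIndepFun (fun n x => M n x) μ := by
      rw [iIndepFun_iff_finset]
      intro s
      refine HasGaussianLaw.iIndepFun_of_covariance_eq_zero ?_ fun i j hij => ?_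
      · exact IsGaussian.hasGaussianLaw_id.map
          (ContinuousLinearMap.pi fun i : s => M i)
      · have h := hM i j fun h => hij (Subtype.ext h)
        have hu := uncenteredCovarianceBilinDual_apply (μ := μ) IsGaussian.memLp_two_id (M i) (M j)
        simp only [covariance, Finset.restrict, hmean, sub_zero]
        exact hu.symm.trans h
    rw [(iIndepFun_iff_map_fun_eq_infinitePi_map fun n => (M n).measurable).mp hind]
    simp only [hv]

/-- The Gaussian correlation inequality. -/
lemma measure_mul_le_inter (hμ : IsCenteredGaussian μ) {A B : Set X} (hA : MeasurableSet A)
    (hB : MeasurableSet B) (hAc : Convex ℝ A) (hBc : Convex ℝ B) (hAs : ∀ x ∈ A, -x ∈ A)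
    (hBs : ∀ x ∈ B, -x ∈ B) : μ A * μ B ≤ μ (A ∩ B) := by
  have : SecondCountableTopology X := UniformSpace.secondCountable_of_separable X
  obtain ⟨M, hM, v, hv⟩ := exists_map_eq_infinitePi hμ
  let T : X →ₗ[ℝ] ℕ → ℝ := LinearMap.pi fun n => (M n).toLinearMap
  let D : (ℕ → ℝ) →ₗ[ℝ] ℕ → ℝ := LinearMap.pi fun n => √(v n) • LinearMap.proj n
  have hTm : Measurable T := measurable_pi_lambda _ fun n => (M n).measurable
  have hDm : Measurable D := measurable_pi_lambda _ fun n => (measurable_pi_apply n).const_mul _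
  have hTi : Function.Injective T := by
    refine (injective_iff_map_eq_zero T).mpr fun x hx => hM x fun n => congrFun hx n
  have hTe : MeasurableEmbedding T := hTm.measurableEmbedding hTi
  have hD : seqGauss.map D = μ.map T := by
    have h := Measure.infinitePi_map_pi (fun _ : ℕ => gaussianReal 0 1)
      (f := fun n x => √(v n) * x) fun n => measurable_id.const_mul _
    refine h.trans (Eq.trans ?_ hv.symm)
    congr 1 with n
    rw [gaussianReal_map_const_mul]
    congr 2
    · simp
    · ext; simp
  have hmeas : ∀ {C : Set X}, MeasurableSet C → μ C = seqGauss (D ⁻¹' (T '' C)) := fun {C} hC => by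
    rw [← Measure.map_apply hDm (hTe.measurableSet_image.mpr hC), hD, hTe.map_apply,
      hTi.preimage_image]
  have hconv : ∀ {C : Set X}, Convex ℝ C → Convex ℝ (D ⁻¹' (T '' C)) := fun hC =>
    (hC.linear_image T).linear_preimage D
  have hsymm : ∀ {C : Set X}, (∀ x ∈ C, -x ∈ C) →
      ∀ z ∈ D ⁻¹' (T '' C), -z ∈ D ⁻¹' (T '' C) := by
    rintro C hC z ⟨x, hx, hxz⟩
    exact ⟨-x, hC x hx, by rw [map_neg, hxz, map_neg]⟩
  have hborel : ∀ {C : Set X}, MeasurableSet C → MeasurableSet (D ⁻¹' (T '' C)) := fun hC =>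
    hDm (hTe.measurableSet_image.mpr hC)
  rw [hmeas hA, hmeas hB, hmeas (hA.inter hB), Set.image_inter hTi, Set.preimage_inter]
  exact seqGauss_mul_le (hborel hA) (hborel hB) (hconv hAc) (hconv hBc) (hsymm hAs) (hsymm hBs)

end Banach

end GaussianCorrelation

/-- Proposition 3.2 of the paper.  Conditioning a centered Gaussian
measure `μ` on a symmetric convex set `A` of positive mass only increases the integral
of a nonnegative symmetric quasi-concave function `f`:
`∫ f d(Π_A(μ)) ≥ ∫ f dμ`, where `Π_A(μ) = μ(A)⁻¹ • μ restricted to A`. -/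
theorem gci_conditioning {X : Type*} [NormedAddCommGroup X] [NormedSpace ℝ X]
    [CompleteSpace X] [TopologicalSpace.SeparableSpace X]
    [MeasurableSpace X] [BorelSpace X]
    (μ : Measure X) (hμ : IsCenteredGaussian μ)
    (A : Set X) (hAmeas : MeasurableSet A) (hAconv : Convex ℝ A)
    (hAsymm : ∀ x ∈ A, -x ∈ A) (hApos : 0 < μ A)
    (f : X → ℝ) (hfm : Measurable f) (hfnonneg : ∀ x, 0 ≤ f x)
    (hfsymm : ∀ x, f (-x) = f x)
    (hfqc : ∀ c : ℝ, Convex ℝ {x | c ≤ f x})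
    (hfi : Integrable f μ) :
    ∫ x, f x ∂μ ≤ ∫ x, f x ∂((μ A)⁻¹ • μ.restrict A) := by
  have := hμ.1
  have hA0 : μ A ≠ 0 := hApos.ne'
  have hint : Integrable f ((μ A)⁻¹ • μ.restrict A) :=
    hfi.restrict.smul_measure (ENNReal.inv_ne_top.mpr hA0)
  rw [integral_eq_lintegral_of_nonneg_ae (ae_of_all _ hfnonneg) hfm.aestronglyMeasurable,
    integral_eq_lintegral_of_nonneg_ae (ae_of_all _ hfnonneg) hfm.aestronglyMeasurable]
  refine ENNReal.toReal_mono hint.lintegral_lt_top.ne ?_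
  rw [lintegral_eq_lintegral_meas_le _ (ae_of_all _ hfnonneg) hfm.aemeasurable,
    lintegral_eq_lintegral_meas_le _ (ae_of_all _ hfnonneg) hfm.aemeasurable]
  refine lintegral_mono fun t => ?_
  have ht : MeasurableSet {x | t ≤ f x} := measurableSet_le measurable_const hfm
  have hgci := GaussianCorrelation.measure_mul_le_inter hμ ht hAmeas (hfqc t) hAconv
    (fun x hx => by simpa only [Set.mem_ofPred_eq, hfsymm] using hx) hAsymm
  rw [Measure.smul_apply, Measure.restrict_apply ht, smul_eq_mul, mul_comm,
    ← div_eq_mul_inv, ENNReal.le_div_iff_mul_le (Or.inl hA0) (Or.inl (measure_ne_top _ _))]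
  exact hgci
end
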